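/- Let (f,ξ) be a classical solution of the Vlasov–Poisson system with point charge on [0,T], with the cutoff decomposition and backward flow (X,V) associated with a fixed t ∈ [0, min(1,T)]. Let m ≥ 3 and γ ∈ (0,1), define k by k+3 = (m+3)(1+γ) and δ = γ/(1+(γ+1)(m+3)) ∈ (0,1). Then ‖ ∫₀ᵗ s ∫_{ℝ³} (|E_int + F_int| f)(t−s, X(s,·,v), V(s,·,v)) dv ds ‖_{L^{m+3}(ℝ³)} ≤ C(γ,m) t^δ H_k(t)^{1/(m+3)}, where C(γ,m) depends only on γ, m, 𝓗(0), M₀, ‖f₀‖_{L∞} and ‖f₀‖_{L¹} (and not on T). -/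

import Mathlib

open MeasureTheory Set Filter
open scoped ENNReal

noncomputable section

/-- Three-dimensional Euclidean space. -/
abbrev E3 : Type := EuclideanSpace ℝ (Fin 3)

/-- Spatial density `ρ(t,x) = ∫ f(t,x,v) dv`. -/
def rho (f : ℝ → E3 → E3 → ℝ) (t : ℝ) (x : E3) : ℝ := ∫ v : E3, f t x v

/-- Self-induced electric field `E(t,x) = ∫ (x-y)/|x-y|³ ρ(t,y) dy`. -/
def Efield (f : ℝ → E3 → E3 → ℝ) (t : ℝ) (x : E3) : E3 :=
  ∫ y : E3, (rho f t y / ‖x - y‖ ^ 3) • (x - y)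

/-- Singular field generated by the point charge located at `ξ t`:
`F(t,x) = (x-ξ(t))/|x-ξ(t)|³`. -/
def Fpt (ξ : ℝ → E3) (t : ℝ) (x : E3) : E3 := (‖x - ξ t‖ ^ 3)⁻¹ • (x - ξ t)

/-- Total mass `M(t) = ∬ f(t,x,v) dx dv`. -/
def mass (f : ℝ → E3 → E3 → ℝ) (t : ℝ) : ℝ := ∫ p : E3 × E3, f t p.1 p.2

/-- Total energy `𝓗(t)`. -/
def energy (f : ℝ → E3 → E3 → ℝ) (ξ η : ℝ → E3) (t : ℝ) : ℝ :=
    (1 / 2) * ∫ p : E3 × E3, ‖p.2‖ ^ 2 * f t p.1 p.2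
  + (1 / 2) * ‖η t‖ ^ 2
  + (1 / 2) * ∫ x : E3, ∫ y : E3, rho f t x * rho f t y / ‖x - y‖
  + ∫ x : E3, rho f t x / ‖x - ξ t‖

/-- `L^∞` norm of the initial datum `‖f₀‖_{L^∞}`. -/
def supf0 (f : ℝ → E3 → E3 → ℝ) : ℝ :=
  (eLpNorm (fun p : E3 × E3 => f 0 p.1 p.2) ⊤ volume).toReal

/-- A classical solution of the Vlasov–Poisson system with point charge on `[0,T]`:
`f` is a nonnegative `C¹` compactly supported density whose initial datum vanishes
in a neighborhood of the charge `ξ 0`, `ξ ∈ C²` with `ξ' = η`, `η' = E(t,ξ(t))`,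
and the Vlasov equation holds pointwise (away from the charge). -/
structure VPClassicalSolution (T : ℝ) where
  f : ℝ → E3 → E3 → ℝ
  ξ : ℝ → E3
  η : ℝ → E3
  T_pos : 0 < T
  f_nonneg : ∀ t x v, 0 ≤ f t x v
  f_c1 : ContDiff ℝ 1 (fun p : ℝ × E3 × E3 => f p.1 p.2.1 p.2.2)
  f_cpt : HasCompactSupport (fun p : ℝ × E3 × E3 => f p.1 p.2.1 p.2.2)
  f0_vanishes_near_charge : ∃ ε > 0, ∀ x v, ‖x - ξ 0‖ < ε → f 0 x v = 0
  ξ_c2 : ContDiff ℝ 2 ξ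
  ξ_ode : ∀ t, HasDerivAt ξ (η t) t
  η_ode : ∀ t ∈ Icc (0 : ℝ) T, HasDerivAt η (Efield f t (ξ t)) t
  vlasov : ∀ t ∈ Icc (0 : ℝ) T, ∀ x v, x ≠ ξ t →
      deriv (fun τ : ℝ => f τ x v) t
      + fderiv ℝ (fun y : E3 => f t y v) x v
      + fderiv ℝ (fun w : E3 => f t x w) v (Efield f t x + Fpt ξ t x) = 0

/-- The microscopic energy function
`h(t,x,v) = |v-η(t)|²/2 + 1/|x-ξ(t)| + 𝓗(0) + M₀⁻¹ + 1`. -/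
def hEnergy (f : ℝ → E3 → E3 → ℝ) (ξ η : ℝ → E3) (t : ℝ) (x v : E3) : ℝ :=
  ‖v - η t‖ ^ 2 / 2 + ‖x - ξ t‖⁻¹ + energy f ξ η 0 + (mass f 0)⁻¹ + 1

/-- The energy moment `H̃_k(t) = ∬ h(t,x,v)^{k/2} f(t,x,v) dx dv`. -/
def Htilde (f : ℝ → E3 → E3 → ℝ) (ξ η : ℝ → E3) (k t : ℝ) : ℝ :=
  ∫ p : E3 × E3, hEnergy f ξ η t p.1 p.2 ^ (k / 2) * f t p.1 p.2

/-- The running supremum of the energy moments `H_k(t) = sup_{0≤s≤t} H̃_k(s)`. -/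
def Hmom (f : ℝ → E3 → E3 → ℝ) (ξ η : ℝ → E3) (k t : ℝ) : ℝ :=
  sSup (Htilde f ξ η k '' Icc 0 t)

/-- Data of a smooth cutoff function `χ₀` together with the constant `K₀ ≥ 100`. -/
structure CutoffData where
  χ : E3 → ℝ
  K0 : ℝ
  K0_ge : 100 ≤ K0
  smooth : ContDiff ℝ (⊤ : ℕ∞) χ
  mem_Icc : ∀ z, χ z ∈ Icc (0 : ℝ) 1
  eq_one : ∀ z, ‖z‖ ≤ 1 → χ z = 1
  eq_zero : ∀ z, 2 ≤ ‖z‖ → χ z = 0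
  grad_le : ∀ z, ‖fderiv ℝ χ z‖ ≤ 2
  hess_le : ∀ z, ‖fderiv ℝ (fderiv ℝ χ) z‖ ≤ 20

/-- The cutoff radius `R = (24 K₀ (1+‖f₀‖_{L¹}))^{1/3} (1+T)`. -/
def Rcut (T : ℝ) (f : ℝ → E3 → E3 → ℝ) (K0 : ℝ) : ℝ :=
  (24 * K0 * (1 + mass f 0)) ^ ((1 : ℝ) / 3) * (1 + T)

/-- The rescaled cutoff `χ_R(z) = χ₀(z/R)`. -/
def chiR (T : ℝ) (f : ℝ → E3 → E3 → ℝ) (c : CutoffData) (z : E3) : ℝ :=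
  c.χ ((Rcut T f c.K0)⁻¹ • z)

/-- Internal part of the self-induced field: `E_int = ρ ∗ (χ_R(x) x/|x|³)`. -/
def Eint (T : ℝ) (f : ℝ → E3 → E3 → ℝ) (c : CutoffData) (t : ℝ) (x : E3) : E3 :=
  ∫ y : E3, (chiR T f c (x - y) * rho f t y / ‖x - y‖ ^ 3) • (x - y)

/-- Internal part of the point-charge field: `F_int(t,x) = F(t,x) χ_R(x-ξ(t))`. -/
def Fint (T : ℝ) (f : ℝ → E3 → E3 → ℝ) (ξ : ℝ → E3) (c : CutoffData) (t : ℝ) (x : E3) : E3 :=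
  chiR T f c (x - ξ t) • Fpt ξ t x

/-- External part of the self-induced field. -/
def Eext (T : ℝ) (f : ℝ → E3 → E3 → ℝ) (c : CutoffData) (t : ℝ) (x : E3) : E3 :=
  Efield f t x - Eint T f c t x

/-- External part of the point-charge field. -/
def Fext (T : ℝ) (f : ℝ → E3 → E3 → ℝ) (ξ : ℝ → E3) (c : CutoffData) (t : ℝ) (x : E3) : E3 :=
  Fpt ξ t x - Fint T f ξ c t x

/-- The backward flow of the field `E_ext + F_ext` associated with the time `t`:
`dX/ds = -V`, `dV/ds = -(E_ext+F_ext)(t-s, X)`, `(X,V)(0,x,v) = (x,v)`. -/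
structure BackwardFlow (T : ℝ) (S : VPClassicalSolution T) (c : CutoffData) (t : ℝ) where
  X : ℝ → E3 → E3 → E3
  V : ℝ → E3 → E3 → E3
  init_X : ∀ x v, X 0 x v = x
  init_V : ∀ x v, V 0 x v = v
  ode_X : ∀ x v, ∀ s ∈ Icc (0 : ℝ) t, HasDerivAt (fun s => X s x v) (-(V s x v)) s
  ode_V : ∀ x v, ∀ s ∈ Icc (0 : ℝ) t, HasDerivAt (fun s => V s x v)
      (-(Eext T S.f c (t - s) (X s x v) + Fext T S.f S.ξ c (t - s) (X s x v))) s

/-- The Duhamel term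
`x ↦ ∫₀ᵗ s ∫ (|E_int + F_int| f)(t-s, X(s,x,v), V(s,x,v)) dv ds`. -/
def Dterm (T : ℝ) (S : VPClassicalSolution T) (c : CutoffData) (t : ℝ)
    (Φ : BackwardFlow T S c t) (x : E3) : ℝ :=
  ∫ s in (0 : ℝ)..t, s * ∫ v : E3,
    ‖Eint T S.f c (t - s) (Φ.X s x v) + Fint T S.f S.ξ c (t - s) (Φ.X s x v)‖
      * S.f (t - s) (Φ.X s x v) (Φ.V s x v)

/-- Optimization over a free scale: a bound by `A (r ^ α + I r ^ (-β))` valid for all `r > 0`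
yields a bound by a power of `I`. -/
lemma le_rpow_of_forall_scale {J I A : ℝ≥0∞} {α β : ℝ} (hα : 0 < α) (hβ : 0 < β) (hA : A ≠ ⊤)
    (h : ∀ r : ℝ, 0 < r → J ≤ A * (ENNReal.ofReal (r ^ α) + I * ENNReal.ofReal (r ^ (-β)))) :
    J ≤ 2 * A * I ^ (α / (α + β)) := by
  have hαβ : 0 < α + β := by linarith
  have hq : 0 < α / (α + β) := by positivity
  rcases eq_or_ne I 0 with rfl | hI0
  · have hlim : Tendsto (fun r : ℝ => A * ENNReal.ofReal (r ^ α)) (nhdsWithin 0 (Ioi 0))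
        (nhds (A * 0)) := by
      apply ENNReal.Tendsto.const_mul _ (Or.inr hA)
      have h1 : Tendsto (fun r : ℝ => r ^ α) (nhdsWithin 0 (Ioi 0)) (nhds 0) := by
        have := (Real.continuousAt_rpow_const 0 α (Or.inr hα.le)).tendsto
        rw [Real.zero_rpow hα.ne'] at this
        exact this.mono_left nhdsWithin_le_nhds
      have := ENNReal.tendsto_ofReal h1
      simpa using this
    have hJ : J ≤ A * 0 := by
      refine ge_of_tendsto hlim ?_
      filter_upwards [self_mem_nhdsWithin] with r hr
      simpa using h r hr
    exact hJ.trans (by simp)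
  rcases eq_or_ne I ⊤ with rfl | hIt
  · rcases eq_or_ne A 0 with rfl | hA0
    · simpa using h 1 one_pos
    · rw [ENNReal.top_rpow_of_pos hq, ENNReal.mul_top (by simp [hA0])]
      exact le_top
  · have hi : 0 < I.toReal := ENNReal.toReal_pos hI0 hIt
    set i := I.toReal
    have hIi : I = ENNReal.ofReal i := (ENNReal.ofReal_toReal hIt).symm
    have hr : 0 < i ^ (1 / (α + β)) := Real.rpow_pos_of_pos hi _
    have h1 := h _ hr
    have e1 : (i ^ (1 / (α + β))) ^ α = i ^ (α / (α + β)) := by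
      rw [← Real.rpow_mul hi.le]; congr 1; ring
    have e2 : i * (i ^ (1 / (α + β))) ^ (-β) = i ^ (α / (α + β)) := by
      rw [← Real.rpow_mul hi.le]
      nth_rewrite 1 [← Real.rpow_one i]
      rw [← Real.rpow_add hi]; congr 1; field_simp; ring
    rw [hIi, ← ENNReal.ofReal_mul hi.le, e1, e2] at h1
    rw [hIi, ENNReal.ofReal_rpow_of_pos hi]
    calc J ≤ _ := h1
      _ = _ := by ring

lemma enorm_inv_rpow_eq_ofReal {E : Type*} [NormedAddCommGroup E] {z : E} (hz : z ≠ 0) (a : ℝ) :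
    (‖z‖ₑ⁻¹) ^ a = ENNReal.ofReal (‖z‖ ^ (-a)) := by
  rw [Real.rpow_neg (norm_nonneg _), ← Real.inv_rpow (norm_nonneg _), ← ofReal_norm,
    ← ENNReal.ofReal_inv_of_pos (norm_pos_iff.2 hz),
    ENNReal.ofReal_rpow_of_pos (inv_pos.2 (norm_pos_iff.2 hz))]

lemma integral_Ioi_sq_mul_indicator_rpow {a r : ℝ} (ha : a < 3) (hr : 0 < r) :
    IntegrableOn (fun y : ℝ => y ^ (3 - 1) • (Iio r).indicator (fun y => y ^ (-a)) y) (Ioi 0) ∧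
    ∫ y in Ioi (0 : ℝ), y ^ (3 - 1) • (Iio r).indicator (fun y => y ^ (-a)) y
      = r ^ (3 - a) / (3 - a) := by
  have key : ∀ y ∈ Ioi (0 : ℝ), y ^ (3 - 1) • (Iio r).indicator (fun y => y ^ (-a)) y
      = (Iio r).indicator (fun y => y ^ (2 - a)) y := by
    intro y hy
    by_cases hyr : y ∈ Iio r
    · simp only [indicator_of_mem hyr, smul_eq_mul]
      rw [sub_eq_add_neg, Real.rpow_add hy]; norm_num
    · simp [indicator_of_notMem hyr]
  have hintg : IntegrableOn (fun y : ℝ => y ^ (2 - a)) (Ioo 0 r) := by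
    have := (intervalIntegral.intervalIntegrable_rpow' (a := 0) (b := r) (r := 2 - a)
      (by linarith)).1
    exact this.mono_set Ioo_subset_Ioc_self
  constructor
  · rw [integrableOn_congr_fun key measurableSet_Ioi, integrableOn_indicator_iff measurableSet_Iio]
    simpa [Iio_inter_Ioi] using hintg
  · rw [setIntegral_congr_fun measurableSet_Ioi key, setIntegral_indicator measurableSet_Iio,
      Ioi_inter_Iio, ← integral_Ioc_eq_integral_Ioo, ← intervalIntegral.integral_of_le hr.le,
      integral_rpow (Or.inl (by linarith)), Real.zero_rpow (by linarith)]
    ring_nf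

lemma exists_lintegral_ball_inv_rpow_le {a : ℝ} (ha : a < 3) :
    ∃ C : ℝ≥0∞, C ≠ ⊤ ∧ ∀ (z : E3) (r : ℝ), 0 < r →
      ∫⁻ v in Metric.ball z r, (‖v - z‖ₑ⁻¹) ^ a ≤ C * ENNReal.ofReal (r ^ (3 - a)) := by
  refine ⟨ENNReal.ofReal (3 * volume.real (Metric.ball (0 : E3) 1) / (3 - a)),
    ENNReal.ofReal_ne_top, fun z r hr => ?_⟩
  have h3 : Module.finrank ℝ E3 = 3 := by simp
  obtain ⟨hi, hv⟩ := integral_Ioi_sq_mul_indicator_rpow ha hr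
  set φ : ℝ → ℝ := (Iio r).indicator (fun y => y ^ (-a)) with hφ
  have hintg : Integrable (fun x : E3 => φ ‖x‖) := by
    rw [integrable_fun_norm_addHaar, h3]; exact hi
  have hval := integral_fun_norm_addHaar (volume : Measure E3) φ
  rw [h3, hv] at hval
  have hnn : ∀ x : E3, 0 ≤ φ ‖x‖ := fun x => by
    exact indicator_apply_nonneg fun _ => Real.rpow_nonneg (norm_nonneg _) _
  have e1 : ∫⁻ v in Metric.ball z r, (‖v - z‖ₑ⁻¹) ^ a
      = ∫⁻ v : E3, ENNReal.ofReal (φ ‖v - z‖) := by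
    rw [← lintegral_indicator Metric.isOpen_ball.measurableSet]
    apply lintegral_congr_ae
    have : ∀ᵐ v : E3, v ≠ z := by simp [ae_iff, measure_singleton]
    filter_upwards [this] with v hvz
    by_cases hvr : v ∈ Metric.ball z r
    · rw [indicator_of_mem hvr, enorm_inv_rpow_eq_ofReal (sub_ne_zero.2 hvz), hφ,
        indicator_of_mem (by simpa [dist_eq_norm] using hvr)]
    · rw [indicator_of_notMem hvr, hφ,
        indicator_of_notMem (by simpa [dist_eq_norm] using hvr), ENNReal.ofReal_zero]
  rw [e1, lintegral_sub_right_eq_self (fun v : E3 => ENNReal.ofReal (φ ‖v‖)) z,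
    ← ofReal_integral_eq_lintegral_ofReal hintg (Eventually.of_forall hnn), hval,
    ← ENNReal.ofReal_mul (div_nonneg (by positivity) (by linarith))]
  apply ENNReal.ofReal_le_ofReal
  apply le_of_eq
  simp only [nsmul_eq_mul, smul_eq_mul]
  push_cast
  ring

/-- Riesz potential bound for bounded integrable densities. -/
lemma exists_lintegral_inv_rpow_mul_le {a : ℝ} (ha0 : 0 < a) (ha : a < 3) {F : ℝ≥0∞} (hF : F ≠ ⊤) :
    ∃ C : ℝ≥0∞, C ≠ ⊤ ∧ ∀ (g : E3 → ℝ≥0∞) (_ : ∀ v, g v ≤ F) (z : E3),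
      ∫⁻ v, (‖v - z‖ₑ⁻¹) ^ a * g v ≤ C * (∫⁻ v, g v) ^ ((3 - a) / 3) := by
  obtain ⟨C, hC, hball⟩ := exists_lintegral_ball_inv_rpow_le ha
  refine ⟨2 * (C * F + 1), by finiteness, fun g hg z => ?_⟩
  have := le_rpow_of_forall_scale (J := ∫⁻ v, (‖v - z‖ₑ⁻¹) ^ a * g v) (I := ∫⁻ v, g v)
    (A := C * F + 1) (α := 3 - a) (β := a) (by linarith) ha0 (by finiteness) ?_
  · simpa using this
  intro r hr
  rw [← lintegral_add_compl _ (Metric.isOpen_ball (x := z) (ε := r)).measurableSet, mul_add]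
  gcongr ?_ + ?_
  · calc ∫⁻ v in Metric.ball z r, (‖v - z‖ₑ⁻¹) ^ a * g v
        ≤ ∫⁻ v in Metric.ball z r, (‖v - z‖ₑ⁻¹) ^ a * F := by gcongr; exact hg _
      _ = (∫⁻ v in Metric.ball z r, (‖v - z‖ₑ⁻¹) ^ a) * F :=
          lintegral_mul_const' _ _ hF
      _ ≤ (C * ENNReal.ofReal (r ^ (3 - a))) * F := by gcongr; exact hball z r hr
      _ = C * F * ENNReal.ofReal (r ^ (3 - a)) := by ring
      _ ≤ _ := by gcongr; exact le_self_add
  · calc ∫⁻ v in (Metric.ball z r)ᶜ, (‖v - z‖ₑ⁻¹) ^ a * g v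
        ≤ ∫⁻ v in (Metric.ball z r)ᶜ, ENNReal.ofReal (r ^ (-a)) * g v := by
          apply setLIntegral_mono' Metric.isOpen_ball.measurableSet.compl
          intro v hv
          gcongr
          have hv' : r ≤ ‖v - z‖ := by simpa [dist_eq_norm] using hv
          have : v - z ≠ 0 := by rw [← norm_pos_iff]; linarith
          rw [enorm_inv_rpow_eq_ofReal this]
          exact ENNReal.ofReal_le_ofReal
            (Real.rpow_le_rpow_of_nonpos hr hv' (by linarith))
      _ = ENNReal.ofReal (r ^ (-a)) * ∫⁻ v in (Metric.ball z r)ᶜ, g v :=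
          lintegral_const_mul' _ _ ENNReal.ofReal_ne_top
      _ ≤ ENNReal.ofReal (r ^ (-a)) * ∫⁻ v, g v := by gcongr; exact Measure.restrict_le_self
      _ = 1 * ((∫⁻ v, g v) * ENNReal.ofReal (r ^ (-a))) := by ring
      _ ≤ _ := by gcongr; exact le_add_self

/-- Splitting a weighted moment at the level `r` of the weight. -/
lemma lintegral_rpow_mul_le_scale {j k : ℝ} (hj : 0 ≤ j) (hjk : j < k) {F D : ℝ≥0∞}
    {g w : E3 → ℝ≥0∞} (hg : ∀ v, g v ≤ F) (hw : Measurable w)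
    (hD : ∀ r : ℝ, 0 < r → volume {v | w v ≤ ENNReal.ofReal r} ≤ D * ENNReal.ofReal (r ^ (3 : ℝ)))
    {r : ℝ} (hr : 0 < r) :
    ∫⁻ v, w v ^ j * g v ≤ (F * D + 1) * (ENNReal.ofReal (r ^ (j + 3))
      + (∫⁻ v, w v ^ k * g v) * ENNReal.ofReal (r ^ (-(k - j)))) := by
  have hS : MeasurableSet {v | w v ≤ ENNReal.ofReal r} := measurableSet_le hw measurable_const
  rw [← lintegral_add_compl _ hS, mul_add]
  gcongr ?_ + ?_
  · calc ∫⁻ v in {v | w v ≤ ENNReal.ofReal r}, w v ^ j * g v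
        ≤ ∫⁻ v in {v | w v ≤ ENNReal.ofReal r}, ENNReal.ofReal (r ^ j) * F := by
          apply setLIntegral_mono' hS
          intro v hv
          rw [← ENNReal.ofReal_rpow_of_pos hr]
          gcongr
          · exact hv
          · exact hg v
      _ = ENNReal.ofReal (r ^ j) * F * volume {v | w v ≤ ENNReal.ofReal r} := by simp
      _ ≤ ENNReal.ofReal (r ^ j) * F * (D * ENNReal.ofReal (r ^ (3 : ℝ))) := by
          gcongr; exact hD r hr
      _ = F * D * ENNReal.ofReal (r ^ (j + 3)) := by
          rw [Real.rpow_add hr, ENNReal.ofReal_mul (by positivity)]; ring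
      _ ≤ _ := by gcongr; exact le_self_add
  · calc ∫⁻ v in {v | w v ≤ ENNReal.ofReal r}ᶜ, w v ^ j * g v
        ≤ ∫⁻ v in {v | w v ≤ ENNReal.ofReal r}ᶜ,
            ENNReal.ofReal (r ^ (-(k - j))) * (w v ^ k * g v) := by
          apply setLIntegral_mono' hS.compl
          intro v hv
          rw [← mul_assoc]
          gcongr
          have hv' : ENNReal.ofReal r ≤ w v := (not_le.1 (show ¬ w v ≤ ENNReal.ofReal r from hv)).le
          have h1 : w v ^ k = w v ^ (k - j) * w v ^ j := by
            rw [← ENNReal.rpow_add_of_nonneg _ _ (by linarith) hj]; congr 1; ring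
          rw [h1, ← mul_assoc]
          calc w v ^ j = ENNReal.ofReal (r ^ (-(k - j))) * ENNReal.ofReal (r ^ (k - j)) * w v ^ j := by
                rw [← ENNReal.ofReal_mul (by positivity), ← Real.rpow_add hr]; simp
            _ ≤ _ := by
                rw [← ENNReal.ofReal_rpow_of_pos (p := k - j) hr]
                gcongr
      _ = ENNReal.ofReal (r ^ (-(k - j))) * ∫⁻ v in {v | w v ≤ ENNReal.ofReal r}ᶜ, w v ^ k * g v :=
          lintegral_const_mul' _ _ ENNReal.ofReal_ne_top
      _ ≤ ENNReal.ofReal (r ^ (-(k - j))) * ∫⁻ v, w v ^ k * g v := by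
          gcongr; exact Measure.restrict_le_self
      _ = 1 * ((∫⁻ v, w v ^ k * g v) * ENNReal.ofReal (r ^ (-(k - j)))) := by ring
      _ ≤ _ := by gcongr; exact le_add_self

/-- Interpolation of velocity moments of a bounded density. -/
lemma lintegral_rpow_mul_le_rpow {j k : ℝ} (hj : 0 ≤ j) (hjk : j < k) {F D : ℝ≥0∞}
    (hF : F ≠ ⊤) (hDt : D ≠ ⊤)
    {g w : E3 → ℝ≥0∞} (hg : ∀ v, g v ≤ F) (hw : Measurable w)
    (hD : ∀ r : ℝ, 0 < r → volume {v | w v ≤ ENNReal.ofReal r} ≤ D * ENNReal.ofReal (r ^ (3 : ℝ))) :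
    ∫⁻ v, w v ^ j * g v ≤ 2 * (F * D + 1) * (∫⁻ v, w v ^ k * g v) ^ ((j + 3) / (k + 3)) := by
  have := le_rpow_of_forall_scale (J := ∫⁻ v, w v ^ j * g v) (I := ∫⁻ v, w v ^ k * g v)
    (A := F * D + 1) (α := j + 3) (β := k - j) (by linarith) (by linarith) (by finiteness)
    (fun r hr => lintegral_rpow_mul_le_scale hj hjk hg hw hD hr)
  rwa [show j + 3 + (k - j) = k + 3 by ring] at this

/-- Newtonian potential bound for a density controlled by a local moment of order `k`. -/
lemma exists_lintegral_inv_mul_le_rpow {k : ℝ} (hk : 3 / 2 < k) {A M : ℝ≥0∞}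
    (hA : A ≠ ⊤) (hM : M ≠ ⊤) :
    ∃ C : ℝ≥0∞, C ≠ ⊤ ∧ ∀ ρ N : E3 → ℝ≥0∞,
      (∀ y, ∀ r : ℝ, 0 < r →
        ρ y ≤ A * (ENNReal.ofReal (r ^ (3 : ℝ)) + N y * ENNReal.ofReal (r ^ (-k)))) →
      ∫⁻ y, ρ y ≤ M → ∀ z : E3,
      ∫⁻ y, ‖y - z‖ₑ⁻¹ * ρ y ≤ C * (∫⁻ y, N y) ^ (1 / k) := by
  have hk0 : 0 < k := by linarith
  have ha : 1 + 3 / k < 3 := by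
    have : 3 / k < 2 := by rw [div_lt_iff₀ hk0]; linarith
    linarith
  obtain ⟨C, hC, hball⟩ := exists_lintegral_ball_inv_rpow_le ha
  refine ⟨2 * (A * C + A + M), by finiteness, fun ρ N hρ hρM z => ?_⟩
  have := le_rpow_of_forall_scale (J := ∫⁻ y, ‖y - z‖ₑ⁻¹ * ρ y) (I := ∫⁻ y, N y)
    (A := A * C + A + M) (α := 1) (β := k - 1) one_pos (by linarith) (by finiteness) ?_
  · rwa [show 1 + (k - 1) = k by ring] at this
  intro r hr
  have hr' : 0 < r⁻¹ := inv_pos.2 hr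
  set H := ∫⁻ y, N y
  have near : ∫⁻ y in Metric.ball z r⁻¹, ‖y - z‖ₑ⁻¹ * ρ y
      ≤ A * C * ENNReal.ofReal r + A * (H * ENNReal.ofReal (r ^ (-(k - 1)))) := by
    calc ∫⁻ y in Metric.ball z r⁻¹, ‖y - z‖ₑ⁻¹ * ρ y
        ≤ ∫⁻ y in Metric.ball z r⁻¹,
            (A * ENNReal.ofReal (r ^ ((k - 1) * 3 / k)) * (‖y - z‖ₑ⁻¹) ^ (1 + 3 / k)
            + A * ENNReal.ofReal (r ^ (-(k - 1))) * N y) := by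
          apply lintegral_mono_ae
          have : ∀ᵐ y : E3 ∂(volume.restrict (Metric.ball z r⁻¹)), y ≠ z := by
            apply ae_restrict_of_ae
            simp [ae_iff, measure_singleton]
          filter_upwards [this] with y hy
          have hyz : y - z ≠ 0 := sub_ne_zero.2 hy
          have hn : 0 < ‖y - z‖ := norm_pos_iff.2 hyz
          set n := ‖y - z‖ with hndef
          have hs : 0 < (r ^ (k - 1) / n) ^ (1 / k) := by positivity
          have h1 := hρ y _ hs
          have e0 : ‖y - z‖ₑ⁻¹ = ENNReal.ofReal (n ^ (-1 : ℝ)) := by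
            rw [← enorm_inv_rpow_eq_ofReal hyz, ENNReal.rpow_one]
          have hb : 0 < r ^ (k - 1) / n := by positivity
          have e1 : n ^ (-1 : ℝ) * ((r ^ (k - 1) / n) ^ (1 / k)) ^ (3 : ℝ)
              = r ^ ((k - 1) * 3 / k) * n ^ (-(1 + 3 / k)) := by
            rw [← Real.rpow_mul hb.le, Real.div_rpow (by positivity) hn.le, ← Real.rpow_mul hr.le,
              div_eq_mul_inv, ← Real.rpow_neg hn.le, mul_left_comm, ← Real.rpow_add hn]
            congr 2 <;> ring
          have e2 : n ^ (-1 : ℝ) * ((r ^ (k - 1) / n) ^ (1 / k)) ^ (-k) = r ^ (-(k - 1)) := by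
            rw [← Real.rpow_mul hb.le, show 1 / k * -k = -1 by field_simp,
              Real.div_rpow (by positivity) hn.le, ← Real.rpow_mul hr.le, Real.rpow_neg_one n]
            rw [show (k - 1) * -1 = -(k - 1) by ring]
            field_simp
          calc ‖y - z‖ₑ⁻¹ * ρ y ≤ ‖y - z‖ₑ⁻¹ * _ := mul_le_mul_right h1 _
            _ = A * (ENNReal.ofReal (n ^ (-1 : ℝ) * ((r ^ (k - 1) / n) ^ (1 / k)) ^ (3 : ℝ))
                + N y * ENNReal.ofReal (n ^ (-1 : ℝ) * ((r ^ (k - 1) / n) ^ (1 / k)) ^ (-k))) := by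
                rw [e0, ENNReal.ofReal_mul (by positivity), ENNReal.ofReal_mul (by positivity)]
                ring
            _ = _ := by
                rw [e1, e2, enorm_inv_rpow_eq_ofReal hyz, ENNReal.ofReal_mul (by positivity)]
                ring
      _ = A * ENNReal.ofReal (r ^ ((k - 1) * 3 / k))
              * (∫⁻ y in Metric.ball z r⁻¹, (‖y - z‖ₑ⁻¹) ^ (1 + 3 / k))
            + A * ENNReal.ofReal (r ^ (-(k - 1))) * ∫⁻ y in Metric.ball z r⁻¹, N y := by
          rw [lintegral_add_left (by fun_prop), lintegral_const_mul' _ _ (by finiteness),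
            lintegral_const_mul' _ _ (by finiteness)]
      _ ≤ A * ENNReal.ofReal (r ^ ((k - 1) * 3 / k))
              * (C * ENNReal.ofReal (r⁻¹ ^ (3 - (1 + 3 / k))))
            + A * ENNReal.ofReal (r ^ (-(k - 1))) * H := by
          gcongr
          · exact hball z _ hr'
          · exact lintegral_mono' Measure.restrict_le_self le_rfl
      _ = _ := by
          have : r ^ ((k - 1) * 3 / k) * r⁻¹ ^ (3 - (1 + 3 / k)) = r := by
            rw [Real.inv_rpow hr.le, ← Real.rpow_neg hr.le, ← Real.rpow_add hr]
            nth_rewrite 2 [← Real.rpow_one r]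
            congr 1; field_simp; ring
          have h2 : ENNReal.ofReal r = ENNReal.ofReal (r ^ ((k - 1) * 3 / k))
              * ENNReal.ofReal (r⁻¹ ^ (3 - (1 + 3 / k))) := by
            rw [← ENNReal.ofReal_mul (by positivity), this]
          rw [h2]
          ring
  have far : ∫⁻ y in (Metric.ball z r⁻¹)ᶜ, ‖y - z‖ₑ⁻¹ * ρ y ≤ M * ENNReal.ofReal r := by
    calc ∫⁻ y in (Metric.ball z r⁻¹)ᶜ, ‖y - z‖ₑ⁻¹ * ρ y
        ≤ ∫⁻ y in (Metric.ball z r⁻¹)ᶜ, ENNReal.ofReal r * ρ y := by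
          apply setLIntegral_mono' Metric.isOpen_ball.measurableSet.compl
          intro v hv
          gcongr
          have hv' : r⁻¹ ≤ ‖v - z‖ := by simpa [dist_eq_norm] using hv
          rw [← ofReal_norm, ← ENNReal.ofReal_inv_of_pos (lt_of_lt_of_le hr' hv')]
          apply ENNReal.ofReal_le_ofReal
          exact inv_le_of_inv_le₀ hr hv'
      _ = ENNReal.ofReal r * ∫⁻ y in (Metric.ball z r⁻¹)ᶜ, ρ y :=
          lintegral_const_mul' _ _ ENNReal.ofReal_ne_top
      _ ≤ ENNReal.ofReal r * M := by
          gcongr; exact (lintegral_mono' Measure.restrict_le_self le_rfl).trans hρM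
      _ = _ := mul_comm _ _
  rw [← lintegral_add_compl _ (Metric.isOpen_ball (x := z) (ε := r⁻¹)).measurableSet]
  refine (add_le_add near far).trans ?_
  rw [Real.rpow_one]
  set P := H * ENNReal.ofReal (r ^ (-(k - 1)))
  set Q := ENNReal.ofReal r
  calc A * C * Q + A * P + M * Q ≤ A * C * Q + A * P + M * Q + (A * Q + (A * C + M) * P) := le_self_add
    _ = _ := by ring

/-- Hölder interpolation of the kernel `K ^ 2` between a more singular power and `K`. -/
lemma lintegral_sq_mul_le_interpolation {α : Type*} [MeasurableSpace α] {μ : Measure α}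
    {K σ : α → ℝ≥0∞} (hK : Measurable K) (hσ : Measurable σ) {θ : ℝ} (h0 : 0 < θ) (h1 : θ < 1) :
    ∫⁻ y, K y ^ (2 : ℝ) * σ y ∂μ
      ≤ (∫⁻ y, K y ^ ((2 - θ) / (1 - θ)) * σ y ∂μ) ^ (1 - θ) * (∫⁻ y, K y * σ y ∂μ) ^ θ := by
  have h1' : 0 < 1 - θ := by linarith
  refine le_trans (le_of_eq ?_) (ENNReal.lintegral_mul_norm_pow_le
    (f := fun y => K y ^ ((2 - θ) / (1 - θ)) * σ y) (g := fun y => K y * σ y)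
    ((hK.pow_const _).mul hσ).aemeasurable (hK.mul hσ).aemeasurable h1'.le h0.le (by ring))
  apply lintegral_congr
  intro y
  rw [ENNReal.mul_rpow_of_nonneg _ _ h1'.le, ENNReal.mul_rpow_of_nonneg _ _ h0.le,
    ← ENNReal.rpow_mul, div_mul_cancel₀ _ h1'.ne', mul_mul_mul_comm,
    ← ENNReal.rpow_add_of_nonneg _ _ (by linarith) h0.le,
    ← ENNReal.rpow_add_of_nonneg _ _ h1'.le h0.le]
  norm_num

lemma enorm_inv_le_of_norm_le {v w : E3} {σ : ℝ} (hσ : 0 < σ) (h : ‖v‖ ≤ σ * ‖w‖) :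
    ‖w‖ₑ⁻¹ ≤ ENNReal.ofReal σ * ‖v‖ₑ⁻¹ := by
  have h' : ‖v‖ₑ ≤ ENNReal.ofReal σ * ‖w‖ₑ := by
    rw [← ofReal_norm, ← ofReal_norm, ← ENNReal.ofReal_mul hσ.le]
    exact ENNReal.ofReal_le_ofReal h
  have hσ0 : ENNReal.ofReal σ ≠ 0 := by simpa using hσ
  calc ‖w‖ₑ⁻¹ = ENNReal.ofReal σ * (ENNReal.ofReal σ * ‖w‖ₑ)⁻¹ := by
        rw [ENNReal.mul_inv (Or.inl hσ0) (Or.inl ENNReal.ofReal_ne_top), ← mul_assoc,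
          ENNReal.mul_inv_cancel hσ0 ENNReal.ofReal_ne_top, one_mul]
    _ ≤ _ := by gcongr

/-- Singular kernels composed with an expanding map. -/
lemma exists_lintegral_comp_inv_rpow_mul_le {a : ℝ} (ha0 : 0 < a) (ha : a < 3) {F : ℝ≥0∞}
    (hF : F ≠ ⊤) :
    ∃ C : ℝ≥0∞, C ≠ ⊤ ∧ ∀ (g : E3 → ℝ≥0∞) (_ : ∀ v, g v ≤ F) (X : E3 → E3) (σ : ℝ) (_ : 0 < σ)
      (_ : ∀ y, ∃ v₀, ∀ v, ‖v - v₀‖ ≤ σ * ‖X v - y‖) (y : E3),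
      ∫⁻ v, (‖X v - y‖ₑ⁻¹) ^ a * g v
        ≤ C * ENNReal.ofReal σ ^ a * (∫⁻ v, g v) ^ ((3 - a) / 3) := by
  obtain ⟨C, hC, h⟩ := exists_lintegral_inv_rpow_mul_le ha0 ha hF
  refine ⟨C, hC, fun g hg X σ hσ hX y => ?_⟩
  obtain ⟨v₀, hv₀⟩ := hX y
  calc ∫⁻ v, (‖X v - y‖ₑ⁻¹) ^ a * g v
      ≤ ∫⁻ v, ENNReal.ofReal σ ^ a * ((‖v - v₀‖ₑ⁻¹) ^ a * g v) := by
        apply lintegral_mono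
        intro v
        dsimp only
        rw [← mul_assoc, ← ENNReal.mul_rpow_of_nonneg _ _ ha0.le]
        gcongr
        exact enorm_inv_le_of_norm_le hσ (hv₀ v)
    _ = ENNReal.ofReal σ ^ a * ∫⁻ v, (‖v - v₀‖ₑ⁻¹) ^ a * g v :=
        lintegral_const_mul' _ _ (by finiteness)
    _ ≤ ENNReal.ofReal σ ^ a * (C * (∫⁻ v, g v) ^ ((3 - a) / 3)) := by gcongr; exact h g hg v₀
    _ = _ := by ring

lemma interpolation_exponent_bounds {θ : ℝ} (h0 : 0 < θ) (h1 : θ < 1 / 2) :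
    0 < (2 - θ) / (1 - θ) ∧ (2 - θ) / (1 - θ) < 3 ∧
      (3 - (2 - θ) / (1 - θ)) / 3 * (1 - θ) = (1 - 2 * θ) / 3 := by
  have h : 0 < 1 - θ := by linarith
  refine ⟨by apply div_pos <;> linarith, by rw [div_lt_iff₀ h]; linarith, ?_⟩
  field_simp; ring

/-- Velocity average of the point-charge force along an expanding map. -/
lemma exists_lintegral_comp_inv_sq_mul_le {θ : ℝ} (h0 : 0 < θ) (h1 : θ < 1 / 2) {F : ℝ≥0∞}
    (hF : F ≠ ⊤) :
    ∃ C : ℝ≥0∞, C ≠ ⊤ ∧ ∀ (g : E3 → ℝ≥0∞) (_ : ∀ v, g v ≤ F) (_ : Measurable g)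
      (X : E3 → E3) (_ : Measurable X) (σ : ℝ) (_ : 0 < σ)
      (_ : ∀ y, ∃ v₀, ∀ v, ‖v - v₀‖ ≤ σ * ‖X v - y‖) (y : E3),
      ∫⁻ v, (‖X v - y‖ₑ⁻¹) ^ (2 : ℝ) * g v
        ≤ C * ENNReal.ofReal σ ^ (2 - θ) * (∫⁻ v, g v) ^ ((1 - 2 * θ) / 3)
          * (∫⁻ v, ‖X v - y‖ₑ⁻¹ * g v) ^ θ := by
  obtain ⟨e1, e2, e3⟩ := interpolation_exponent_bounds h0 h1
  have h' : 0 < 1 - θ := by linarith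
  obtain ⟨C, hC, h⟩ := exists_lintegral_comp_inv_rpow_mul_le e1 e2 hF
  refine ⟨C ^ (1 - θ), by finiteness, fun g hg hgm X hXm σ hσ hX y => ?_⟩
  refine (lintegral_sq_mul_le_interpolation (K := fun v => ‖X v - y‖ₑ⁻¹) (by fun_prop) hgm h0
    (by linarith)).trans ?_
  gcongr
  refine (ENNReal.rpow_le_rpow (h g hg X σ hσ hX y) h'.le).trans (le_of_eq ?_)
  rw [ENNReal.mul_rpow_of_nonneg _ _ h'.le, ENNReal.mul_rpow_of_nonneg _ _ h'.le,
    ← ENNReal.rpow_mul, ← ENNReal.rpow_mul, e3, div_mul_cancel₀ _ h'.ne']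

/-- Velocity average of the self-induced force along an expanding map. -/
lemma exists_lintegral_comp_potential_mul_le {θ k : ℝ} (h0 : 0 < θ) (h1 : θ < 1 / 2)
    (hk : 3 / 2 < k) {F A M : ℝ≥0∞} (hF : F ≠ ⊤) (hA : A ≠ ⊤) (hM : M ≠ ⊤) :
    ∃ C : ℝ≥0∞, C ≠ ⊤ ∧ ∀ (g : E3 → ℝ≥0∞) (_ : ∀ v, g v ≤ F) (_ : Measurable g)
      (X : E3 → E3) (_ : Measurable X) (σ : ℝ) (_ : 0 < σ)
      (_ : ∀ y, ∃ v₀, ∀ v, ‖v - v₀‖ ≤ σ * ‖X v - y‖)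
      (ρ N : E3 → ℝ≥0∞) (_ : Measurable ρ) (_ : ∫⁻ y, ρ y ≤ M)
      (_ : ∀ y, ∀ r : ℝ, 0 < r →
        ρ y ≤ A * (ENNReal.ofReal (r ^ (3 : ℝ)) + N y * ENNReal.ofReal (r ^ (-k)))),
      ∫⁻ v, (∫⁻ y, (‖X v - y‖ₑ⁻¹) ^ (2 : ℝ) * ρ y) * g v
        ≤ C * ENNReal.ofReal σ ^ (2 - θ) * (∫⁻ y, N y) ^ (θ / k)
          * (∫⁻ v, g v) ^ ((1 + θ) / 3) := by
  obtain ⟨e1, e2, e3⟩ := interpolation_exponent_bounds h0 h1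
  have h' : 0 < 1 - θ := by linarith
  obtain ⟨C, hC, h⟩ := exists_lintegral_comp_inv_rpow_mul_le e1 e2 hF
  obtain ⟨C', hC', hU⟩ := exists_lintegral_inv_mul_le_rpow hk hA hM
  refine ⟨C' ^ θ * (C * M) ^ (1 - θ), by finiteness,
    fun g hg hgm X hXm σ hσ hX ρ N hρm hρM hρ => ?_⟩
  set a := (2 - θ) / (1 - θ)
  set G := ∫⁻ v, g v
  set H := ∫⁻ y, N y
  have hinner : ∀ v, ∫⁻ y, (‖X v - y‖ₑ⁻¹) ^ (2 : ℝ) * ρ y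
      ≤ (∫⁻ y, (‖X v - y‖ₑ⁻¹) ^ a * ρ y) ^ (1 - θ) * (C' * H ^ (1 / k)) ^ θ := by
    intro v
    refine (lintegral_sq_mul_le_interpolation (K := fun y => ‖X v - y‖ₑ⁻¹) (by fun_prop) hρm h0
      (by linarith)).trans ?_
    gcongr
    simpa only [enorm_sub_rev] using hU ρ N hρ hρM (X v)
  have hm : Measurable fun v => ∫⁻ y, (‖X v - y‖ₑ⁻¹) ^ a * ρ y :=
    Measurable.lintegral_prod_right' (f := fun p : E3 × E3 => (‖X p.1 - p.2‖ₑ⁻¹) ^ a * ρ p.2)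
      (by fun_prop)
  have hswap : ∫⁻ v, (∫⁻ y, (‖X v - y‖ₑ⁻¹) ^ a * ρ y) * g v
      ≤ C * M * ENNReal.ofReal σ ^ a * G ^ ((3 - a) / 3) := by
    calc ∫⁻ v, (∫⁻ y, (‖X v - y‖ₑ⁻¹) ^ a * ρ y) * g v
        = ∫⁻ v, ∫⁻ y, (‖X v - y‖ₑ⁻¹) ^ a * ρ y * g v := by
          congr 1; ext v
          rw [lintegral_mul_const]; fun_prop
      _ = ∫⁻ y, ∫⁻ v, (‖X v - y‖ₑ⁻¹) ^ a * ρ y * g v := by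
          rw [lintegral_lintegral_swap]
          exact Measurable.aemeasurable (by simp only [Function.uncurry_def]; fun_prop)
      _ = ∫⁻ y, ρ y * ∫⁻ v, (‖X v - y‖ₑ⁻¹) ^ a * g v := by
          congr 1; ext y
          rw [← lintegral_const_mul _ (by fun_prop)]
          congr 1; ext v; ring
      _ ≤ ∫⁻ y, ρ y * (C * ENNReal.ofReal σ ^ a * G ^ ((3 - a) / 3)) := by
          gcongr with y
          exact h g hg X σ hσ hX y
      _ = (∫⁻ y, ρ y) * (C * ENNReal.ofReal σ ^ a * G ^ ((3 - a) / 3)) :=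
          lintegral_mul_const _ hρm
      _ ≤ M * (C * ENNReal.ofReal σ ^ a * G ^ ((3 - a) / 3)) := by gcongr
      _ = _ := by ring
  calc ∫⁻ v, (∫⁻ y, (‖X v - y‖ₑ⁻¹) ^ (2 : ℝ) * ρ y) * g v
      ≤ ∫⁻ v, (C' * H ^ (1 / k)) ^ θ *
          (((∫⁻ y, (‖X v - y‖ₑ⁻¹) ^ a * ρ y) * g v) ^ (1 - θ) * g v ^ θ) := by
        apply lintegral_mono
        intro v
        dsimp only
        have hgs : g v = g v ^ (1 - θ) * g v ^ θ := by
          rw [← ENNReal.rpow_add_of_nonneg _ _ h'.le h0.le]; simp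
        rw [ENNReal.mul_rpow_of_nonneg _ _ h'.le]
        calc _ ≤ _ := mul_le_mul_left (hinner v) _
          _ = (∫⁻ y, (‖X v - y‖ₑ⁻¹) ^ a * ρ y) ^ (1 - θ) * (C' * H ^ (1 / k)) ^ θ
              * (g v ^ (1 - θ) * g v ^ θ) := by rw [← hgs]
          _ = _ := by ring
    _ = (C' * H ^ (1 / k)) ^ θ *
          ∫⁻ v, ((∫⁻ y, (‖X v - y‖ₑ⁻¹) ^ a * ρ y) * g v) ^ (1 - θ) * g v ^ θ := by
        rw [lintegral_const_mul]; fun_prop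
    _ ≤ (C' * H ^ (1 / k)) ^ θ * ((C * M * ENNReal.ofReal σ ^ a * G ^ ((3 - a) / 3)) ^ (1 - θ)
          * G ^ θ) := by
        gcongr
        refine (ENNReal.lintegral_mul_norm_pow_le (hm.mul hgm).aemeasurable hgm.aemeasurable
          h'.le h0.le (by ring)).trans ?_
        gcongr
        exact hswap
    _ = _ := by
        rw [ENNReal.mul_rpow_of_nonneg _ _ h0.le, ENNReal.mul_rpow_of_nonneg _ _ h'.le,
          ENNReal.mul_rpow_of_nonneg _ _ h'.le, ← ENNReal.rpow_mul, ← ENNReal.rpow_mul,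
          ← ENNReal.rpow_mul, e3, div_mul_cancel₀ _ h'.ne',
          show (1 + θ) / 3 = (1 - 2 * θ) / 3 + θ by ring,
          ENNReal.rpow_add_of_nonneg ((1 - 2 * θ) / 3) θ (by linarith) h0.le,
          show 1 / k * θ = θ / k by ring]
        ring

/-- Expanding maps increase Haar measure. -/
lemma AntilipschitzWith.addHaar_preimage_le {E : Type*} [NormedAddCommGroup E] [NormedSpace ℝ E]
    [FiniteDimensional ℝ E] [MeasurableSpace E] [BorelSpace E] (μ : Measure E) [μ.IsAddHaarMeasure]
    {K : NNReal} {f : E → E} (hf : AntilipschitzWith K f) (s : Set E) :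
    μ (f ⁻¹' s) ≤ (K : ℝ≥0∞) ^ (Module.finrank ℝ E) * μ s := by
  have h := hf.hausdorffMeasure_preimage_le (d := Module.finrank ℝ E) (by positivity) s
  rw [Measure.isAddLeftInvariant_eq_smul μ (Measure.hausdorffMeasure (Module.finrank ℝ E))]
  rw [ENNReal.rpow_natCast] at h
  simp only [Measure.smul_apply]
  simp only [ENNReal.smul_def, smul_eq_mul]
  rw [mul_left_comm]
  gcongr

lemma AntilipschitzWith.lintegral_comp_le {E : Type*} [NormedAddCommGroup E] [NormedSpace ℝ E]
    [FiniteDimensional ℝ E] [MeasurableSpace E] [BorelSpace E] (μ : Measure E) [μ.IsAddHaarMeasure]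
    {K : NNReal} {f : E → E} (hf : AntilipschitzWith K f) (hfm : Measurable f)
    {G : E → ℝ≥0∞} (hG : Measurable G) :
    ∫⁻ x, G (f x) ∂μ ≤ (K : ℝ≥0∞) ^ (Module.finrank ℝ E) * ∫⁻ x, G x ∂μ := by
  rw [← lintegral_map hG hfm, ← smul_eq_mul, ← lintegral_smul_measure]
  apply lintegral_mono' _ le_rfl
  rw [Measure.le_iff]
  intro s hs
  rw [Measure.map_apply hfm hs, Measure.smul_apply, smul_eq_mul]
  exact hf.addHaar_preimage_le μ s

lemma norm_coulomb_kernel_sub_le {z w : E3} (hz : 1 ≤ ‖z‖) (hw : 1 ≤ ‖w‖) :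
    ‖(‖z‖ ^ 3)⁻¹ • z - (‖w‖ ^ 3)⁻¹ • w‖ ≤ 4 * ‖z - w‖ := by
  set a := ‖z‖ with ha
  set b := ‖w‖ with hb
  have ha0 : 0 < a := by linarith
  have hb0 : 0 < b := by linarith
  have hab : |b - a| ≤ ‖z - w‖ := by
    rw [abs_sub_comm]; exact abs_norm_sub_norm_le z w
  have e : (a ^ 3)⁻¹ • z - (b ^ 3)⁻¹ • w = (a ^ 3)⁻¹ • (z - w) + ((a ^ 3)⁻¹ - (b ^ 3)⁻¹) • w := by
    rw [smul_sub, sub_smul]; abel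
  rw [e]
  refine (norm_add_le _ _).trans ?_
  rw [norm_smul, norm_smul, Real.norm_of_nonneg (by positivity), ← hb, Real.norm_eq_abs]
  have h1 : (a ^ 3)⁻¹ ≤ 1 := inv_le_one_of_one_le₀ (one_le_pow₀ hz)
  have h2 : |(a ^ 3)⁻¹ - (b ^ 3)⁻¹| * b ≤ 3 * |b - a| := by
    have e2 : (a ^ 3)⁻¹ - (b ^ 3)⁻¹ = (b - a) * (b ^ 2 + a * b + a ^ 2) / (a ^ 3 * b ^ 3) := by
      field_simp; ring
    rw [e2, abs_div, abs_mul, abs_of_pos (a := b ^ 2 + a * b + a ^ 2) (by positivity),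
      abs_of_pos (a := a ^ 3 * b ^ 3) (by positivity), div_mul_eq_mul_div, div_le_iff₀ (by positivity)]
    have h3 : (b ^ 2 + a * b + a ^ 2) ≤ 3 * (a ^ 3 * b ^ 2) := by
      have ha2 : 1 ≤ a ^ 2 := one_le_pow₀ hz
      have hb2 : 1 ≤ b ^ 2 := one_le_pow₀ hw
      have ha3 : 1 ≤ a ^ 3 := one_le_pow₀ hz
      have t1 : b ^ 2 ≤ a ^ 3 * b ^ 2 := le_mul_of_one_le_left (by positivity) ha3
      have t2 : a * b ≤ a ^ 3 * b ^ 2 := by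
        calc a * b ≤ (a * b) * (a ^ 2 * b) :=
              le_mul_of_one_le_right (by positivity) (one_le_mul_of_one_le_of_one_le ha2 hw)
          _ = _ := by ring
      have t3 : a ^ 2 ≤ a ^ 3 * b ^ 2 := by
        calc a ^ 2 ≤ a ^ 2 * (a * b ^ 2) :=
              le_mul_of_one_le_right (by positivity) (one_le_mul_of_one_le_of_one_le hz hb2)
          _ = _ := by ring
      linarith
    calc |b - a| * (b ^ 2 + a * b + a ^ 2) * b
        ≤ |b - a| * (3 * (a ^ 3 * b ^ 2)) * b := by gcongr
      _ = _ := by ring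
  have h4 := mul_le_mul_of_nonneg_right h1 (norm_nonneg (z - w))
  linarith

lemma CutoffData.abs_sub_le (c : CutoffData) (z w : E3) : |c.χ z - c.χ w| ≤ 2 * ‖z - w‖ := by
  have := Convex.norm_image_sub_le_of_norm_fderiv_le (𝕜 := ℝ) (f := c.χ) (s := univ) (C := 2)
    (fun x _ => (c.smooth.differentiable (by simp)).differentiableAt) (fun x _ => c.grad_le x)
    convex_univ (mem_univ w) (mem_univ z)
  simpa [Real.norm_eq_abs] using this

/-- The exterior Coulomb kernel `(1 - χ₀(z)) z / |z| ^ 3` is globally Lipschitz. -/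
lemma CutoffData.norm_exterior_kernel_sub_le (c : CutoffData) (z w : E3) :
    ‖((1 - c.χ z) * (‖z‖ ^ 3)⁻¹) • z - ((1 - c.χ w) * (‖w‖ ^ 3)⁻¹) • w‖ ≤ 6 * ‖z - w‖ := by
  have one_side : ∀ z w : E3, ‖z‖ ≤ 1 → 1 ≤ ‖w‖ →
      ‖((1 - c.χ w) * (‖w‖ ^ 3)⁻¹) • w‖ ≤ 6 * ‖z - w‖ := by
    intro z w hz hw
    have hw0 : 0 < ‖w‖ := by linarith
    have h0 := c.mem_Icc w
    have h1 := c.abs_sub_le z w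
    rw [c.eq_one z hz, abs_of_nonneg (by linarith [h0.2])] at h1
    rw [norm_smul, norm_mul, Real.norm_of_nonneg (by linarith [h0.2]),
      Real.norm_of_nonneg (by positivity), mul_assoc]
    have h2 : (‖w‖ ^ 3)⁻¹ * ‖w‖ ≤ 1 := by
      rw [inv_mul_le_iff₀ (by positivity), mul_one]
      exact le_self_pow₀ hw (by norm_num)
    calc (1 - c.χ w) * ((‖w‖ ^ 3)⁻¹ * ‖w‖) ≤ (1 - c.χ w) * 1 := by
          gcongr; linarith [h0.2]
      _ ≤ _ := by linarith [norm_nonneg (z - w)]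
  rcases le_total ‖z‖ 1 with hz | hz <;> rcases le_total ‖w‖ 1 with hw | hw
  · simp [c.eq_one z hz, c.eq_one w hw]
  · simpa [c.eq_one z hz] using one_side z w hz hw
  · simpa [c.eq_one w hw, norm_sub_rev z w] using one_side w z hw hz
  · have hz0 : 0 < ‖z‖ := by linarith
    have e : ((1 - c.χ z) * (‖z‖ ^ 3)⁻¹) • z - ((1 - c.χ w) * (‖w‖ ^ 3)⁻¹) • w
        = (c.χ w - c.χ z) • ((‖z‖ ^ 3)⁻¹ • z)
          + (1 - c.χ w) • ((‖z‖ ^ 3)⁻¹ • z - (‖w‖ ^ 3)⁻¹ • w) := by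
      module
    rw [e]
    refine (norm_add_le _ _).trans ?_
    have hc := c.mem_Icc w
    rw [norm_smul, norm_smul, norm_smul, Real.norm_of_nonneg (by positivity : 0 ≤ (‖z‖ ^ 3)⁻¹),
      Real.norm_eq_abs, Real.norm_of_nonneg (by linarith [hc.2] : 0 ≤ 1 - c.χ w)]
    have h1 := c.abs_sub_le w z
    rw [norm_sub_rev] at h1
    have h2 : (‖z‖ ^ 3)⁻¹ * ‖z‖ ≤ 1 := by
      rw [inv_mul_le_iff₀ (by positivity), mul_one]
      exact le_self_pow₀ hz (by norm_num)
    have h3 := norm_coulomb_kernel_sub_le hz hw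
    calc |c.χ w - c.χ z| * ((‖z‖ ^ 3)⁻¹ * ‖z‖)
          + (1 - c.χ w) * ‖(‖z‖ ^ 3)⁻¹ • z - (‖w‖ ^ 3)⁻¹ • w‖
        ≤ (2 * ‖z - w‖) * 1 + 1 * (4 * ‖z - w‖) := by
          gcongr
          linarith [hc.1]
      _ = _ := by ring

/-- The rescaled exterior Coulomb kernel is Lipschitz with constant of order `R ^ (-3)`. -/
lemma CutoffData.norm_rescaled_exterior_kernel_sub_le (c : CutoffData) {R : ℝ} (hR : 0 < R)
    (z w : E3) :
    ‖((1 - c.χ (R⁻¹ • z)) * (‖z‖ ^ 3)⁻¹) • z - ((1 - c.χ (R⁻¹ • w)) * (‖w‖ ^ 3)⁻¹) • w‖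
      ≤ 6 / R ^ 3 * ‖z - w‖ := by
  have key : ∀ z : E3, ((1 - c.χ (R⁻¹ • z)) * (‖z‖ ^ 3)⁻¹) • z
      = (R ^ 2)⁻¹ • (((1 - c.χ (R⁻¹ • z)) * (‖R⁻¹ • z‖ ^ 3)⁻¹) • (R⁻¹ • z)) := by
    intro z
    rw [norm_smul, Real.norm_of_nonneg (by positivity), smul_smul, smul_smul]
    congr 1
    rw [mul_pow, mul_inv]
    field_simp
  rw [key z, key w, ← smul_sub, norm_smul, Real.norm_of_nonneg (by positivity)]
  calc (R ^ 2)⁻¹ * _ ≤ (R ^ 2)⁻¹ * (6 * ‖R⁻¹ • z - R⁻¹ • w‖) := by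
        gcongr; exact c.norm_exterior_kernel_sub_le _ _
    _ = _ := by
        rw [← smul_sub, norm_smul, Real.norm_of_nonneg (by positivity)]
        field_simp

lemma integral_fderiv_apply_eq_zero {E : Type*} [NormedAddCommGroup E] [NormedSpace ℝ E]
    [FiniteDimensional ℝ E] [MeasurableSpace E] [BorelSpace E] {μ : Measure E} [μ.IsAddHaarMeasure]
    {g : E → ℝ} (hg : ContDiff ℝ 1 g) (hgc : HasCompactSupport g) (w : E) :
    ∫ x, fderiv ℝ g x w ∂μ = 0 := by
  have hi : Integrable (fun x => fderiv ℝ g x w) μ :=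
    ((hg.continuous_fderiv (by simp)).clm_apply continuous_const).integrable_of_hasCompactSupport
      (hgc.fderiv_apply ℝ w)
  have := integral_mul_fderiv_eq_neg_fderiv_mul_of_integrable (μ := μ) (f := fun _ : E => (1 : ℝ))
    (g := g) (v := w) (by simp) (by simpa using hi)
    (by simpa using hg.continuous.integrable_of_hasCompactSupport hgc)
    (fun _ _ => by fun_prop) (fun x _ => (hg.differentiable (by simp)).differentiableAt)
  simpa using this

/-- Subsolutions of a transport equation whose force field depends only on time and position
have nonincreasing integral. -/
lemma integral_le_of_transport_subsolution {T : ℝ} {W : ℝ → E3 → E3} {ξ : ℝ → E3}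
    {g : ℝ × E3 × E3 → ℝ} (hg : ContDiff ℝ 1 g) (hgc : HasCompactSupport g)
    (h : ∀ t ∈ Icc 0 T, ∀ x v, x ≠ ξ t → fderiv ℝ g (t, x, v) (1, v, W t x) ≤ 0)
    {τ : ℝ} (hτ : τ ∈ Icc 0 T) :
    ∫ p : E3 × E3, g (τ, p) ≤ ∫ p : E3 × E3, g (0, p) := by
  have hgd : Differentiable ℝ g := hg.differentiable (by simp)
  have hg' : Continuous (fderiv ℝ g) := hg.continuous_fderiv (by simp)
  have hg'c : HasCompactSupport (fderiv ℝ g) := hgc.fderiv ℝ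
  obtain ⟨B, hB⟩ := hg'c.exists_bound_of_continuous hg'
  have hz : ∀ t : ℝ, ∀ p : E3 × E3, p ∉ Prod.snd '' (tsupport (fderiv ℝ g)) →
      fderiv ℝ g (t, p) = 0 := fun t p hp =>
    image_eq_zero_of_notMem_tsupport fun hm => hp ⟨_, hm, rfl⟩
  have hK : IsCompact (Prod.snd '' (tsupport (fderiv ℝ g))) :=
    hg'c.isCompact.image continuous_snd
  have hcs : ∀ t : ℝ, HasCompactSupport fun p : E3 × E3 => g (t, p) := fun t =>
    HasCompactSupport.intro (hgc.isCompact.image continuous_snd) fun p hp =>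
      image_eq_zero_of_notMem_tsupport fun hm => hp ⟨_, hm, rfl⟩
  have hderiv : ∀ t : ℝ, HasDerivAt (fun t => ∫ p : E3 × E3, g (t, p))
      (∫ p : E3 × E3, fderiv ℝ g (t, p) (1, 0)) t := by
    intro t
    refine (hasDerivAt_integral_of_dominated_loc_of_deriv_le (s := univ)
      (F := fun t (p : E3 × E3) => g (t, p)) (F' := fun t (p : E3 × E3) => fderiv ℝ g (t, p) (1, 0))
      (bound := (Prod.snd '' (tsupport (fderiv ℝ g))).indicator
        (fun _ => B * ‖((1 : ℝ), (0 : E3 × E3))‖)) univ_mem ?_ ?_ ?_ ?_ ?_ ?_).2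
    · exact Eventually.of_forall fun s =>
        (hg.continuous.comp (by fun_prop : Continuous fun p : E3 × E3 => (s, p))).aestronglyMeasurable
    · exact (hg.continuous.comp
        (by fun_prop : Continuous fun p : E3 × E3 => (t, p))).integrable_of_hasCompactSupport (hcs t)
    · exact ((hg'.comp (by fun_prop : Continuous fun p : E3 × E3 => (t, p))).clm_apply
        continuous_const).aestronglyMeasurable
    · refine Eventually.of_forall fun p s _ => ?_
      by_cases hp : p ∈ Prod.snd '' (tsupport (fderiv ℝ g))
      · rw [indicator_of_mem hp]
        exact (ContinuousLinearMap.le_opNorm _ _).trans (by gcongr; exact hB _)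
      · rw [indicator_of_notMem hp, hz s p hp]; simp
    · rw [integrable_indicator_iff hK.measurableSet]
      exact integrableOn_const hK.measure_lt_top.ne
    · refine Eventually.of_forall fun p s _ => ?_
      have h1 : HasDerivAt (fun s : ℝ => (s, p)) ((1 : ℝ), (0 : E3 × E3)) s :=
        (hasDerivAt_id s).prodMk (hasDerivAt_const s p)
      exact (hgd _).hasFDerivAt.comp_hasDerivAt s h1
  have hintg : ∀ t : ℝ, ∀ w : E3 × E3 → ℝ × E3 × E3, Continuous w →
      Integrable (fun p : E3 × E3 => fderiv ℝ g (t, p) (w p)) := by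
    intro t w hw
    refine ((hg'.comp (by fun_prop : Continuous fun p : E3 × E3 => (t, p))).clm_apply
      hw).integrable_of_hasCompactSupport (HasCompactSupport.intro hK fun p hp => ?_)
    simp [hz t p hp]
  have hxs : ∀ t v w, ∫ x : E3, fderiv ℝ g (t, x, v) (0, w, 0) = 0 := by
    intro t v w
    have hc : ContDiff ℝ 1 fun x : E3 => g (t, x, v) := hg.comp (by fun_prop)
    have := integral_fderiv_apply_eq_zero (μ := volume) hc
      (HasCompactSupport.intro (hgc.isCompact.image (by fun_prop : Continuous
        fun q : ℝ × E3 × E3 => q.2.1)) fun x hx =>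
        image_eq_zero_of_notMem_tsupport fun hm => hx ⟨_, hm, rfl⟩) w
    refine Eq.trans ?_ this
    refine integral_congr_ae (Eventually.of_forall fun x => ?_)
    have h1 : HasFDerivAt (fun x : E3 => (t, x, v))
        ((0 : E3 →L[ℝ] ℝ).prod ((ContinuousLinearMap.id ℝ E3).prod 0)) x :=
      (hasFDerivAt_const t x).prodMk ((hasFDerivAt_id x).prodMk (hasFDerivAt_const v x))
    have h2 := ((hgd (t, x, v)).hasFDerivAt.comp x h1).fderiv
    simp only [Function.comp_def] at h2
    simp only [h2]
    simp
  have hvs : ∀ t x w, ∫ v : E3, fderiv ℝ g (t, x, v) (0, 0, w) = 0 := by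
    intro t x w
    have hc : ContDiff ℝ 1 fun v : E3 => g (t, x, v) := hg.comp (by fun_prop)
    have := integral_fderiv_apply_eq_zero (μ := volume) hc
      (HasCompactSupport.intro (hgc.isCompact.image (by fun_prop : Continuous
        fun q : ℝ × E3 × E3 => q.2.2)) fun x hx =>
        image_eq_zero_of_notMem_tsupport fun hm => hx ⟨_, hm, rfl⟩) w
    refine Eq.trans ?_ this
    refine integral_congr_ae (Eventually.of_forall fun v => ?_)
    have h1 : HasFDerivAt (fun v : E3 => (t, x, v))
        ((0 : E3 →L[ℝ] ℝ).prod ((0 : E3 →L[ℝ] E3).prod (ContinuousLinearMap.id ℝ E3))) v :=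
      (hasFDerivAt_const t v).prodMk ((hasFDerivAt_const x v).prodMk (hasFDerivAt_id v))
    have h2 := ((hgd (t, x, v)).hasFDerivAt.comp v h1).fderiv
    simp only [Function.comp_def] at h2
    simp only [h2]
    simp
  have hnonpos : ∀ t ∈ Icc 0 T, ∫ p : E3 × E3, fderiv ℝ g (t, p) (1, 0) ≤ 0 := by
    intro t ht
    have e1 : ∫ p : E3 × E3, fderiv ℝ g (t, p) (1, 0)
        = ∫ p : E3 × E3, fderiv ℝ g (t, p) (1, p.2, 0) := by
      have e2 : ∫ p : E3 × E3, fderiv ℝ g (t, p) (0, p.2, 0) = 0 := by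
        rw [Measure.volume_eq_prod, integral_prod_symm _ (hintg t _ (by fun_prop))]
        simp [hxs]
      rw [← add_zero (∫ p : E3 × E3, fderiv ℝ g (t, p) (1, 0)), ← e2,
        ← integral_add (hintg t _ (by fun_prop)) (hintg t _ (by fun_prop))]
      refine integral_congr_ae (Eventually.of_forall fun p => ?_)
      simp only [← map_add]
      simp
    have hi := hintg t (fun p => (1, p.2, 0)) (by fun_prop)
    rw [e1, Measure.volume_eq_prod, integral_prod _ hi]
    refine integral_nonpos_of_ae ?_
    rw [Measure.volume_eq_prod] at hi
    have hne : ∀ᵐ x : E3, x ≠ ξ t := by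
      simp [ae_iff]
    filter_upwards [hi.prod_right_ae, hne] with x hx hxξ
    have e3 : ∫ v : E3, fderiv ℝ g (t, x, v) (1, v, 0)
        = ∫ v : E3, fderiv ℝ g (t, x, v) (1, v, W t x) := by
      have hi2 : Integrable fun v : E3 => fderiv ℝ g (t, x, v) (0, 0, W t x) := by
        refine ((hg'.comp (by fun_prop : Continuous fun v : E3 => (t, x, v))).clm_apply
          continuous_const).integrable_of_hasCompactSupport
          (HasCompactSupport.intro (hK.image continuous_snd) fun v hv => ?_)
        simp [hz t (x, v) fun hm => hv ⟨_, hm, rfl⟩]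
      rw [← add_zero (∫ v : E3, fderiv ℝ g (t, x, v) (1, v, 0)), ← hvs t x (W t x),
        ← integral_add hx hi2]
      refine integral_congr_ae (Eventually.of_forall fun p => ?_)
      simp only [← map_add]
      simp
    simp only [Pi.zero_apply]
    rw [e3]
    exact integral_nonpos fun v => h t ht x v hxξ
  have hanti : AntitoneOn (fun t => ∫ p : E3 × E3, g (t, p)) (Icc 0 T) := by
    refine antitoneOn_of_deriv_nonpos (convex_Icc 0 T)
      (fun t _ => (hderiv t).continuousAt.continuousWithinAt)
      (fun t _ => (hderiv t).differentiableAt.differentiableWithinAt) fun t ht => ?_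
    rw [(hderiv t).deriv]
    rw [interior_Icc] at ht
    exact hnonpos t (Ioo_subset_Icc_self ht)
  exact hanti ⟨le_rfl, hτ.1.trans hτ.2⟩ hτ hτ.1

namespace VPClassicalSolution

variable {T : ℝ} (S : VPClassicalSolution T)

lemma continuous_f : Continuous fun p : ℝ × E3 × E3 => S.f p.1 p.2.1 p.2.2 := S.f_c1.continuous

lemma continuous_f_time (t : ℝ) : Continuous fun p : E3 × E3 => S.f t p.1 p.2 :=
  S.continuous_f.comp (by fun_prop : Continuous fun p : E3 × E3 => (t, p))

lemma continuous_f_velocity (t : ℝ) (x : E3) : Continuous fun v : E3 => S.f t x v :=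
  S.continuous_f.comp (by fun_prop : Continuous fun v : E3 => (t, x, v))

lemma hasCompactSupport_f_time (t : ℝ) : HasCompactSupport fun p : E3 × E3 => S.f t p.1 p.2 :=
  HasCompactSupport.intro (S.f_cpt.isCompact.image continuous_snd) fun p hp =>
    image_eq_zero_of_notMem_tsupport (f := fun p : ℝ × E3 × E3 => S.f p.1 p.2.1 p.2.2)
      (x := (t, p)) fun hm => hp ⟨_, hm, rfl⟩

lemma exists_norm_le_of_ne_zero : ∃ r : ℝ, 0 < r ∧ ∀ t x v, S.f t x v ≠ 0 → ‖v‖ ≤ r := by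
  obtain ⟨r, hr⟩ := S.f_cpt.isCompact.isBounded.exists_norm_le
  refine ⟨max r 1, by positivity, fun t x v h => ?_⟩
  have := hr (t, x, v) (subset_tsupport _ h)
  refine le_trans ?_ (le_max_left _ _)
  exact (norm_snd_le (x, v)).trans ((norm_snd_le (t, (x, v))).trans this)

lemma hasCompactSupport_f_velocity (t : ℝ) (x : E3) : HasCompactSupport fun v : E3 => S.f t x v := by
  obtain ⟨r, -, hr⟩ := S.exists_norm_le_of_ne_zero
  refine HasCompactSupport.intro (isCompact_closedBall (0 : E3) r) fun v hv => ?_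
  by_contra h
  exact hv (by simpa using hr t x v h)

lemma integrable_f_time (t : ℝ) : Integrable fun p : E3 × E3 => S.f t p.1 p.2 :=
  (S.continuous_f_time t).integrable_of_hasCompactSupport (S.hasCompactSupport_f_time t)

lemma integrable_f_velocity (t : ℝ) (x : E3) : Integrable fun v : E3 => S.f t x v :=
  (S.continuous_f_velocity t x).integrable_of_hasCompactSupport (S.hasCompactSupport_f_velocity t x)

lemma rho_nonneg (t : ℝ) (x : E3) : 0 ≤ rho S.f t x := integral_nonneg fun _ => S.f_nonneg _ _ _

lemma mass_nonneg (t : ℝ) : 0 ≤ mass S.f t := integral_nonneg fun _ => S.f_nonneg _ _ _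

lemma ofReal_rho (t : ℝ) (x : E3) :
    ENNReal.ofReal (rho S.f t x) = ∫⁻ v, ENNReal.ofReal (S.f t x v) :=
  ofReal_integral_eq_lintegral_ofReal (S.integrable_f_velocity t x)
    (Eventually.of_forall fun _ => S.f_nonneg _ _ _)

lemma measurable_rho : Measurable fun p : ℝ × E3 => rho S.f p.1 p.2 := by
  have : StronglyMeasurable fun q : (ℝ × E3) × E3 => S.f q.1.1 q.1.2 q.2 :=
    (S.continuous_f.comp (by fun_prop : Continuous
      fun q : (ℝ × E3) × E3 => (q.1.1, q.1.2, q.2))).stronglyMeasurable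
  exact this.integral_prod_right.measurable

lemma lintegral_rho (t : ℝ) : ∫⁻ x, ENNReal.ofReal (rho S.f t x) = ENNReal.ofReal (mass S.f t) := by
  simp_rw [S.ofReal_rho]
  rw [mass, ofReal_integral_eq_lintegral_ofReal (S.integrable_f_time t)
    (Eventually.of_forall fun _ => S.f_nonneg _ _ _), Measure.volume_eq_prod,
    lintegral_prod _ (S.continuous_f_time t).measurable.ennreal_ofReal.aemeasurable]

lemma exists_rho_le : ∃ B : ℝ, 0 ≤ B ∧ ∀ t x, rho S.f t x ≤ B := by
  obtain ⟨r, hr0, hr⟩ := S.exists_norm_le_of_ne_zero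
  obtain ⟨B, hB⟩ := S.f_cpt.exists_bound_of_continuous S.continuous_f
  have hB0 : 0 ≤ B := (norm_nonneg _).trans (hB (0, 0, 0))
  refine ⟨B * volume.real (Metric.closedBall (0 : E3) r), by positivity, fun t x => ?_⟩
  have e : rho S.f t x = ∫ v in Metric.closedBall (0 : E3) r, S.f t x v := by
    rw [setIntegral_eq_integral_of_forall_compl_eq_zero]
    · rfl
    · intro v hv
      by_contra h
      exact hv (by simpa using hr t x v h)
  rw [e]
  refine (le_abs_self _).trans ?_
  exact norm_setIntegral_le_of_norm_le_const measure_closedBall_lt_top fun v _ => hB (t, x, v)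

/-- The Vlasov equation in terms of the total derivative. -/
lemma fderiv_f_apply {t : ℝ} (ht : t ∈ Icc 0 T) {x : E3} (v : E3) (hx : x ≠ S.ξ t) :
    fderiv ℝ (fun p : ℝ × E3 × E3 => S.f p.1 p.2.1 p.2.2) (t, x, v)
      (1, v, Efield S.f t x + Fpt S.ξ t x) = 0 := by
  have hd := (S.f_c1.differentiable (by simp) (t, x, v)).hasFDerivAt
  set L := fderiv ℝ (fun p : ℝ × E3 × E3 => S.f p.1 p.2.1 p.2.2) (t, x, v)
  have h := S.vlasov t ht x v hx
  have h1 : HasFDerivAt (fun x : E3 => (t, x, v))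
      ((0 : E3 →L[ℝ] ℝ).prod ((ContinuousLinearMap.id ℝ E3).prod 0)) x :=
    (hasFDerivAt_const t x).prodMk ((hasFDerivAt_id x).prodMk (hasFDerivAt_const v x))
  have h2 : HasFDerivAt (fun v : E3 => (t, x, v))
      ((0 : E3 →L[ℝ] ℝ).prod ((0 : E3 →L[ℝ] E3).prod (ContinuousLinearMap.id ℝ E3))) v :=
    (hasFDerivAt_const t v).prodMk ((hasFDerivAt_const x v).prodMk (hasFDerivAt_id v))
  have h3 : HasDerivAt (fun s : ℝ => (s, x, v)) ((1 : ℝ), (0 : E3 × E3)) t :=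
    (hasDerivAt_id t).prodMk (hasDerivAt_const t (x, v))
  have e1 := (hd.comp x h1).fderiv
  have e2 := (hd.comp v h2).fderiv
  have e3 := (hd.comp_hasDerivAt t h3).deriv
  simp only [Function.comp_def] at e1 e2 e3
  rw [e1, e2, e3] at h
  simp only [ContinuousLinearMap.comp_apply, ContinuousLinearMap.prod_apply,
    zero_apply, ContinuousLinearMap.id_apply, ← map_add] at h
  simpa using h

lemma mass_le {t : ℝ} (ht : t ∈ Icc 0 T) : mass S.f t ≤ mass S.f 0 :=
  integral_le_of_transport_subsolution (W := fun t x => Efield S.f t x + Fpt S.ξ t x) (ξ := S.ξ)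
    S.f_c1 S.f_cpt (fun _ ht _ v hx => (S.fderiv_f_apply ht v hx).le) ht

lemma supf0_nonneg : 0 ≤ supf0 S.f := ENNReal.toReal_nonneg

/-- Maximum principle. -/
lemma f_le_supf0 {t : ℝ} (ht : t ∈ Icc 0 T) (x v : E3) : S.f t x v ≤ supf0 S.f := by
  set a := supf0 S.f with ha
  have ha0 : 0 ≤ a := S.supf0_nonneg
  set g : ℝ × E3 × E3 → ℝ := fun p => expNegInvGlue (S.f p.1 p.2.1 p.2.2 - a) with hg
  have hgc1 : ContDiff ℝ 1 g :=
    (expNegInvGlue.contDiff (n := 1)).comp (S.f_c1.sub contDiff_const)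
  have hgc : HasCompactSupport g := by
    refine HasCompactSupport.intro S.f_cpt.isCompact fun p hp => ?_
    have : S.f p.1 p.2.1 p.2.2 = 0 := image_eq_zero_of_notMem_tsupport
      (f := fun p : ℝ × E3 × E3 => S.f p.1 p.2.1 p.2.2) hp
    simp only [hg, this]
    exact expNegInvGlue.zero_of_nonpos (by linarith)
  have hle := integral_le_of_transport_subsolution (T := T)
    (W := fun t x => Efield S.f t x + Fpt S.ξ t x) (ξ := S.ξ) hgc1 hgc (fun t ht x v hx => by
      have h1 : HasFDerivAt (fun p : ℝ × E3 × E3 => S.f p.1 p.2.1 p.2.2 - a) _ (t, x, v) :=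
        ((S.f_c1.differentiable (by simp) (t, x, v)).hasFDerivAt).sub_const a
      have h2 := ((expNegInvGlue.contDiff (n := 1)).differentiable (by simp)
        (S.f t x v - a)).hasDerivAt
      have h3 := (HasDerivAt.comp_hasFDerivAt (t, x, v) h2 h1).fderiv
      have e : g = expNegInvGlue ∘ fun p : ℝ × E3 × E3 => S.f p.1 p.2.1 p.2.2 - a := rfl
      rw [e, h3, smul_apply, S.fderiv_f_apply ht v hx, smul_zero]) ht
  have h0 : ∫ p : E3 × E3, g (0, p) = 0 := by
    have hmem : MemLp (fun p : E3 × E3 => S.f 0 p.1 p.2) ⊤ volume :=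
      (S.continuous_f_time 0).memLp_of_hasCompactSupport (S.hasCompactSupport_f_time 0)
    have hae : ∀ᵐ p : E3 × E3, S.f 0 p.1 p.2 ≤ a := by
      have h1 := ae_le_eLpNormEssSup (f := fun p : E3 × E3 => S.f 0 p.1 p.2) (μ := volume)
      filter_upwards [h1] with p hp
      rw [← eLpNorm_exponent_top] at hp
      have := ENNReal.toReal_mono hmem.eLpNorm_lt_top.ne hp
      rw [toReal_enorm, Real.norm_of_nonneg (S.f_nonneg _ _ _)] at this
      exact this
    rw [integral_eq_zero_of_ae]
    filter_upwards [hae] with p hp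
    exact expNegInvGlue.zero_of_nonpos (by linarith)
  rw [h0] at hle
  have hnn : ∀ p : E3 × E3, 0 ≤ g (t, p) := fun p => expNegInvGlue.nonneg _
  have hcont : Continuous fun p : E3 × E3 => g (t, p) :=
    hgc1.continuous.comp (by fun_prop)
  have hcs : HasCompactSupport fun p : E3 × E3 => g (t, p) :=
    HasCompactSupport.intro (hgc.isCompact.image continuous_snd) fun p hp =>
      image_eq_zero_of_notMem_tsupport fun hm => hp ⟨_, hm, rfl⟩
  have hz : ∫ p : E3 × E3, g (t, p) = 0 := le_antisymm hle (integral_nonneg hnn)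
  have hz2 := (integral_eq_zero_iff_of_nonneg hnn
    (hcont.integrable_of_hasCompactSupport hcs)).1 hz
  have hz3 := (hcont.ae_eq_iff_eq volume continuous_const).1 hz2
  have hz4 := congrFun hz3 (x, v)
  by_contra hlt
  push Not at hlt
  exact (expNegInvGlue.pos_of_pos (sub_pos.2 hlt)).ne' hz4

end VPClassicalSolution

lemma enorm_coulomb_le {a : ℝ} (ha : 0 ≤ a) (z : E3) :
    ‖(a / ‖z‖ ^ 3) • z‖ₑ ≤ (‖z‖ₑ⁻¹) ^ (2 : ℝ) * ENNReal.ofReal a := by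
  rcases eq_or_ne z 0 with rfl | hz
  · simp
  · have hz0 : 0 < ‖z‖ := norm_pos_iff.2 hz
    rw [enorm_inv_rpow_eq_ofReal hz, ← ENNReal.ofReal_mul (by positivity), ← ofReal_norm,
      norm_smul, Real.norm_of_nonneg (by positivity), Real.rpow_neg hz0.le, Real.rpow_two]
    refine ENNReal.ofReal_le_ofReal (le_of_eq ?_)
    field_simp

namespace VPClassicalSolution

variable {T : ℝ} (S : VPClassicalSolution T)

lemma exists_lintegral_coulomb_le : ∃ C : ℝ≥0∞, C ≠ ⊤ ∧ ∀ t ∈ Icc 0 T, ∀ x : E3,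
    ∫⁻ y, (‖x - y‖ₑ⁻¹) ^ (2 : ℝ) * ENNReal.ofReal (rho S.f t y) ≤ C := by
  obtain ⟨B, -, hB⟩ := S.exists_rho_le
  obtain ⟨C, hC, h⟩ := exists_lintegral_inv_rpow_mul_le (a := 2) (by norm_num) (by norm_num)
    (ENNReal.ofReal_ne_top (r := B))
  refine ⟨C * ENNReal.ofReal (mass S.f 0) ^ ((3 - 2 : ℝ) / 3),
    ENNReal.mul_ne_top hC (ENNReal.rpow_ne_top_of_nonneg (by norm_num) ENNReal.ofReal_ne_top),
    fun t ht x => ?_⟩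
  have := h (fun y => ENNReal.ofReal (rho S.f t y))
    (fun y => ENNReal.ofReal_le_ofReal (hB t y)) x
  simp_rw [enorm_sub_rev x]
  refine this.trans ?_
  rw [S.lintegral_rho]
  gcongr
  exact S.mass_le ht

lemma exists_norm_Efield_le : ∃ C : ℝ, 0 ≤ C ∧ ∀ t ∈ Icc 0 T, ∀ x : E3, ‖Efield S.f t x‖ ≤ C := by
  obtain ⟨C, hC, h⟩ := S.exists_lintegral_coulomb_le
  refine ⟨C.toReal, ENNReal.toReal_nonneg, fun t ht x => ?_⟩
  rw [← toReal_enorm]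
  refine ENNReal.toReal_mono hC ((enorm_integral_le_lintegral_enorm _).trans
    (le_trans (lintegral_mono fun y => ?_) (h t ht x)))
  exact enorm_coulomb_le (S.rho_nonneg t y) _

lemma contDiff_η : ContDiff ℝ 1 S.η := by
  have : S.η = deriv S.ξ := funext fun t => (S.ξ_ode t).deriv.symm
  rw [this]
  have h := S.ξ_c2
  rw [show (2 : WithTop ℕ∞) = 1 + 1 by norm_num, contDiff_succ_iff_deriv] at h
  exact h.2.2

/-- The kinetic energy relative to the charge plus the interaction energy. -/
def relEnergy (t : ℝ) (x v : E3) : ℝ := ‖v - S.η t‖ ^ 2 / 2 + ‖x - S.ξ t‖⁻¹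

lemma hasDerivAt_relEnergy {t : ℝ} (ht : t ∈ Icc 0 T) {x : E3} (v : E3) (hx : x ≠ S.ξ t) :
    HasDerivAt (fun s : ℝ => S.relEnergy (t + s) (x + s • v)
        (v + s • (Efield S.f t x + Fpt S.ξ t x)))
      (inner ℝ (v - S.η t) (Efield S.f t x - Efield S.f t (S.ξ t))) 0 := by
  set W := Efield S.f t x + Fpt S.ξ t x with hW
  have hs : HasDerivAt (fun s : ℝ => t + s) 1 0 := by
    simpa using (hasDerivAt_id (0 : ℝ)).const_add t
  have hη : HasDerivAt (fun s : ℝ => S.η (t + s)) (Efield S.f t (S.ξ t)) 0 := by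
    have := HasDerivAt.scomp (0 : ℝ) (g₁ := S.η) (h := fun s : ℝ => t + s)
      (by simpa using S.η_ode t ht) hs
    simpa [Function.comp_def] using this
  have hξ : HasDerivAt (fun s : ℝ => S.ξ (t + s)) (S.η t) 0 := by
    have := HasDerivAt.scomp (0 : ℝ) (g₁ := S.ξ) (h := fun s : ℝ => t + s)
      (by simpa using S.ξ_ode t) hs
    simpa [Function.comp_def] using this
  have hl : ∀ a b : E3, HasDerivAt (fun s : ℝ => a + s • b) b 0 := fun a b => by
    simpa using ((hasDerivAt_id (0 : ℝ)).smul_const b).const_add a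
  have h1 := ((hl v W).sub hη).norm_sq
  have h2 := ((hl x v).sub hξ).norm_sq
  have hz : 0 < ‖x - S.ξ t‖ := norm_pos_iff.2 (sub_ne_zero.2 hx)
  have h3 := (h2.sqrt (by simpa using hz.ne')).inv (by simpa using hz.ne')
  have h4 := (h1.div_const 2).add h3
  simp only [zero_smul, add_zero, Real.sqrt_sq (norm_nonneg _), Pi.sub_apply] at h4
  have h5 : HasDerivAt (fun s : ℝ => S.relEnergy (t + s) (x + s • v) (v + s • W)) _ 0 := h4
  refine h5.congr_deriv ?_
  have e : inner ℝ (v - S.η t) (Fpt S.ξ t x)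
      = (‖x - S.ξ t‖ ^ 3)⁻¹ * inner ℝ (x - S.ξ t) (v - S.η t) := by
    rw [Fpt, inner_smul_right, real_inner_comm]
  rw [hW, inner_sub_right (v - S.η t), inner_sub_right (v - S.η t), inner_add_right, e]
  field_simp
  ring

lemma exists_relEnergy_le : ∃ B : ℝ, 0 ≤ B ∧ ∀ t ∈ Icc 0 T, ∀ x v, S.f t x v ≠ 0 →
    x ≠ S.ξ t ∧ S.relEnergy t x v ≤ B := by
  obtain ⟨r, hr0, hr⟩ := S.exists_norm_le_of_ne_zero
  obtain ⟨CE, hCE0, hCE⟩ := S.exists_norm_Efield_le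
  obtain ⟨ε, hε, hvan⟩ := S.f0_vanishes_near_charge
  obtain ⟨Cη, hCη⟩ := isCompact_Icc.exists_bound_of_continuousOn
    (s := Icc 0 T) S.contDiff_η.continuous.continuousOn
  have hCη0 : 0 ≤ Cη := (norm_nonneg _).trans (hCη 0 ⟨le_rfl, S.T_pos.le⟩)
  set C := (r + Cη) * (2 * CE) with hC
  have hC0 : 0 ≤ C := by positivity
  set A := (r + Cη) ^ 2 / 2 + ε⁻¹ with hA
  have hA0 : 0 ≤ A := by positivity
  have hdiff : ∀ t ∈ Icc 0 T, ∀ x v, S.f t x v ≠ 0 → ‖v - S.η t‖ ≤ r + Cη := fun t ht x v h =>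
    (norm_sub_le _ _).trans (add_le_add (hr t x v h) (hCη t ht))
  set u : ℝ × E3 × E3 → ℝ := fun p => S.relEnergy p.1 p.2.1 p.2.2 - A - C * p.1 with hu
  classical
  set φ : ℝ × E3 × E3 → ℝ := fun p => if p.2.1 = S.ξ p.1 then 1 else Real.smoothTransition (u p)
    with hφ
  have hξc : Continuous S.ξ := S.ξ_c2.continuous
  have hloc : ∀ p : ℝ × E3 × E3, p.2.1 ≠ S.ξ p.1 →
      φ =ᶠ[nhds p] fun p => Real.smoothTransition (u p) := by
    intro p hp
    have : ∀ᶠ q : ℝ × E3 × E3 in nhds p, q.2.1 ≠ S.ξ q.1 :=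
      (isOpen_ne_fun (by fun_prop) (by fun_prop)).mem_nhds hp
    filter_upwards [this] with q hq
    simp [hφ, hq]
  have hφc : ContDiff ℝ 1 φ := by
    rw [contDiff_iff_contDiffAt]
    intro p
    by_cases hp : p.2.1 = S.ξ p.1
    · have hop : ∀ᶠ q : ℝ × E3 × E3 in nhds p, ‖q.2.1 - S.ξ q.1‖ * (|A + C * q.1| + 1) < 1 := by
        refine (isOpen_lt (by fun_prop) continuous_const).mem_nhds ?_
        simp [hp]
      refine (contDiffAt_const (c := (1 : ℝ))).congr_of_eventuallyEq ?_
      filter_upwards [hop] with q hq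
      by_cases hq2 : q.2.1 = S.ξ q.1
      · simp [hφ, hq2]
      · simp only [hφ, if_neg hq2]
        refine Real.smoothTransition.one_of_one_le ?_
        have hz : 0 < ‖q.2.1 - S.ξ q.1‖ := norm_pos_iff.2 (sub_ne_zero.2 hq2)
        have h1 : |A + C * q.1| + 1 ≤ ‖q.2.1 - S.ξ q.1‖⁻¹ := by
          rw [← one_div, le_div_iff₀ hz, mul_comm]; exact hq.le
        have h2 := le_abs_self (A + C * q.1)
        have h3 : 0 ≤ ‖q.2.2 - S.η q.1‖ ^ 2 / 2 := by positivity
        simp only [hu, relEnergy]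
        linarith
    · refine ContDiffAt.congr_of_eventuallyEq ?_ (hloc p hp)
      refine (Real.smoothTransition.contDiff (n := 1)).contDiffAt.comp p ?_
      have c1 : ContDiffAt ℝ 1 (fun p : ℝ × E3 × E3 => p.2.1 - S.ξ p.1) p :=
        ((contDiff_fst.comp contDiff_snd).sub
          ((S.ξ_c2.of_le (by norm_num)).comp contDiff_fst)).contDiffAt
      have c2 : ContDiffAt ℝ 1 (fun p : ℝ × E3 × E3 => p.2.2 - S.η p.1) p :=
        ((contDiff_snd.comp contDiff_snd).sub (S.contDiff_η.comp contDiff_fst)).contDiffAt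
      have hz : p.2.1 - S.ξ p.1 ≠ 0 := sub_ne_zero.2 hp
      exact ((((c2.norm_sq ℝ).div_const 2).add
        ((c1.norm ℝ hz).inv (norm_ne_zero_iff.2 hz))).sub contDiffAt_const).sub
          (contDiffAt_const.mul contDiffAt_fst)
  set g : ℝ × E3 × E3 → ℝ := fun p => φ p * S.f p.1 p.2.1 p.2.2 with hg
  have hgc1 : ContDiff ℝ 1 g := hφc.mul S.f_c1
  have hgc : HasCompactSupport g := S.f_cpt.mul_left
  have hφ0 : ∀ p, 0 ≤ φ p := by
    intro p
    simp only [hφ]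
    split_ifs
    · norm_num
    · exact Real.smoothTransition.nonneg _
  have hnn : ∀ p, 0 ≤ g p := fun p => mul_nonneg (hφ0 p) (S.f_nonneg _ _ _)
  have hsub : ∀ t ∈ Icc 0 T, ∀ x v, x ≠ S.ξ t →
      fderiv ℝ g (t, x, v) (1, v, Efield S.f t x + Fpt S.ξ t x) ≤ 0 := by
    intro t ht x v hx
    set W := Efield S.f t x + Fpt S.ξ t x with hW
    have hfl : fderiv ℝ g (t, x, v) (1, v, W) = φ (t, x, v) * 0
        + S.f t x v * fderiv ℝ φ (t, x, v) (1, v, W) := by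
      have h1 := (hφc.differentiable (by simp) (t, x, v)).hasFDerivAt.mul
        (S.f_c1.differentiable (by simp) (t, x, v)).hasFDerivAt
      have h2 : fderiv ℝ g (t, x, v) = _ := h1.fderiv
      rw [h2, add_apply, smul_apply, smul_apply, S.fderiv_f_apply ht v hx, smul_eq_mul, smul_eq_mul]
    rw [hfl, mul_zero, zero_add]
    by_cases hf : S.f t x v = 0
    · simp [hf]
    refine mul_nonpos_of_nonneg_of_nonpos (S.f_nonneg _ _ _) ?_
    have hline : HasDerivAt (fun s : ℝ => (t + s, x + s • v, v + s • W)) ((1 : ℝ), v, W) 0 := by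
      have hl : ∀ a b : E3, HasDerivAt (fun s : ℝ => a + s • b) b 0 := fun a b => by
        simpa using ((hasDerivAt_id (0 : ℝ)).smul_const b).const_add a
      have hs : HasDerivAt (fun s : ℝ => t + s) 1 0 := by
        simpa using (hasDerivAt_id (0 : ℝ)).const_add t
      exact hs.prodMk ((hl x v).prodMk (hl v W))
    have hcomp : HasDerivAt (fun s : ℝ => φ (t + s, x + s • v, v + s • W))
        (fderiv ℝ φ (t, x, v) (1, v, W)) 0 := by
      have h1 : HasFDerivAt φ (fderiv ℝ φ (t, x, v)) (t + (0 : ℝ), x + (0 : ℝ) • v, v + (0 : ℝ) • W) := by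
        simpa using (hφc.differentiable (by simp) (t, x, v)).hasFDerivAt
      exact h1.comp_hasDerivAt (0 : ℝ) hline
    have hu' : HasDerivAt (fun s : ℝ => u (t + s, x + s • v, v + s • W))
        (inner ℝ (v - S.η t) (Efield S.f t x - Efield S.f t (S.ξ t)) - C) 0 := by
      have hs : HasDerivAt (fun s : ℝ => C * (t + s)) C 0 := by
        simpa using ((hasDerivAt_id (0 : ℝ)).const_add t).const_mul C
      exact ((S.hasDerivAt_relEnergy ht v hx).sub_const A).sub hs
    have htr := ((Real.smoothTransition.contDiff (n := 1)).differentiable (by simp)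
      (u (t + (0 : ℝ), x + (0 : ℝ) • v, v + (0 : ℝ) • W))).hasDerivAt
    have hcomp2 := htr.comp (0 : ℝ) hu'
    have hev : (fun s : ℝ => φ (t + s, x + s • v, v + s • W)) =ᶠ[nhds 0]
        Real.smoothTransition ∘ fun s : ℝ => u (t + s, x + s • v, v + s • W) := by
      have hc0 : Filter.Tendsto (fun s : ℝ => (t + s, x + s • v, v + s • W)) (nhds 0)
          (nhds (t, x, v)) := by
        simpa using hline.continuousAt.tendsto
      exact hc0.eventually (hloc (t, x, v) hx)
    rw [hcomp.unique (hcomp2.congr_of_eventuallyEq hev)]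
    refine mul_nonpos_of_nonneg_of_nonpos (Real.smoothTransition.monotone.deriv_nonneg) ?_
    have h1 : inner ℝ (v - S.η t) (Efield S.f t x - Efield S.f t (S.ξ t))
        ≤ (r + Cη) * (2 * CE) := by
      refine (real_inner_le_norm _ _).trans ?_
      gcongr
      · exact hdiff t ht x v hf
      · refine (norm_sub_le _ _).trans ?_
        linarith [hCE t ht x, hCE t ht (S.ξ t)]
    linarith
  have h0 : ∀ p : E3 × E3, g (0, p) = 0 := by
    intro p
    by_cases hf : S.f 0 p.1 p.2 = 0
    · simp [hg, hf]
    have hd : ε ≤ ‖p.1 - S.ξ 0‖ := by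
      by_contra hlt
      exact hf (hvan _ _ (not_le.1 hlt))
    have hne : p.1 ≠ S.ξ 0 := by
      intro h
      rw [h, sub_self, norm_zero] at hd
      linarith
    have hle : u (0, p) ≤ 0 := by
      simp only [hu, relEnergy, hA]
      have h1 : ‖p.2 - S.η 0‖ ^ 2 ≤ (r + Cη) ^ 2 := by
        gcongr
        exact hdiff 0 ⟨le_rfl, S.T_pos.le⟩ _ _ hf
      have h2 : ‖p.1 - S.ξ 0‖⁻¹ ≤ ε⁻¹ := inv_anti₀ hε hd
      linarith
    simp [hg, hφ, hne, Real.smoothTransition.zero_of_nonpos hle]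
  refine ⟨A + C * T, by have := S.T_pos; positivity, fun t ht x v hf => ?_⟩
  have hle := integral_le_of_transport_subsolution hgc1 hgc hsub ht
  simp only [h0, integral_zero] at hle
  have hcont : Continuous fun p : E3 × E3 => g (t, p) := hgc1.continuous.comp (by fun_prop)
  have hcs : HasCompactSupport fun p : E3 × E3 => g (t, p) :=
    HasCompactSupport.intro (hgc.isCompact.image continuous_snd) fun p hp =>
      image_eq_zero_of_notMem_tsupport fun hm => hp ⟨_, hm, rfl⟩
  have hz := (integral_eq_zero_iff_of_nonneg (fun p => hnn (t, p))
    (hcont.integrable_of_hasCompactSupport hcs)).1 (le_antisymm hle (integral_nonneg fun p => hnn _))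
  have hz2 := congrFun ((hcont.ae_eq_iff_eq volume continuous_const).1 hz) (x, v)
  have hz3 : φ (t, x, v) = 0 := (mul_eq_zero.1 hz2).resolve_right hf
  have hx : x ≠ S.ξ t := by
    intro h
    simp [hφ, h] at hz3
  refine ⟨hx, ?_⟩
  simp only [hφ, if_neg hx] at hz3
  by_contra hlt
  have hCt : C * t ≤ C * T := by gcongr; exact ht.2
  have : 0 < u (t, x, v) := by
    simp only [hu]
    linarith
  exact (Real.smoothTransition.pos_of_pos this).ne' hz3

end VPClassicalSolution

namespace VPClassicalSolution

variable {T : ℝ} (S : VPClassicalSolution T)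

lemma energy_nonneg (t : ℝ) : 0 ≤ energy S.f S.ξ S.η t := by
  have hρ := S.rho_nonneg t
  have hf := S.f_nonneg t
  unfold energy
  refine mul_nonneg (by norm_num) (integral_nonneg fun p => ?_)
  refine add_nonneg (add_nonneg (mul_nonneg (by positivity) (hf _ _)) (by positivity))
    (mul_nonneg (by norm_num) (integral_nonneg fun x => integral_nonneg fun y => ?_))
  exact add_nonneg (div_nonneg (mul_nonneg (hρ _) (hρ _)) (norm_nonneg _))
    (integral_nonneg fun z => div_nonneg (hρ _) (norm_nonneg _))

lemma relEnergy_nonneg (t : ℝ) (x v : E3) : 0 ≤ S.relEnergy t x v := by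
  unfold relEnergy; positivity

lemma hEnergy_eq (t : ℝ) (x v : E3) : hEnergy S.f S.ξ S.η t x v
    = S.relEnergy t x v + (energy S.f S.ξ S.η 0 + (mass S.f 0)⁻¹ + 1) := by
  unfold hEnergy relEnergy; ring

lemma relEnergy_add_one_le_hEnergy (t : ℝ) (x v : E3) :
    S.relEnergy t x v + 1 ≤ hEnergy S.f S.ξ S.η t x v := by
  have := S.energy_nonneg 0
  have h2 := inv_nonneg.2 (S.mass_nonneg 0)
  rw [hEnergy_eq]
  linarith

lemma one_le_hEnergy (t : ℝ) (x v : E3) : 1 ≤ hEnergy S.f S.ξ S.η t x v := by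
  linarith [S.relEnergy_add_one_le_hEnergy t x v, S.relEnergy_nonneg t x v]

lemma measurable_hEnergy :
    Measurable fun p : ℝ × E3 × E3 => hEnergy S.f S.ξ S.η p.1 p.2.1 p.2.2 := by
  have h1 : Continuous S.ξ := S.ξ_c2.continuous
  have h2 : Continuous S.η := S.contDiff_η.continuous
  have h3 : Continuous fun p : ℝ × E3 × E3 => ‖p.2.2 - S.η p.1‖ ^ 2 / 2 := by fun_prop
  have h4 : Continuous fun p : ℝ × E3 × E3 => ‖p.2.1 - S.ξ p.1‖ := by fun_prop
  unfold hEnergy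
  exact (((h3.measurable.add h4.measurable.inv).add_const _).add_const _).add_const _

/-- The square root of the energy function, as a weight with values in `[0, ∞]`. -/
def weight (t : ℝ) (x v : E3) : ℝ≥0∞ := ENNReal.ofReal (√(hEnergy S.f S.ξ S.η t x v))

lemma measurable_weight : Measurable fun p : ℝ × E3 × E3 => S.weight p.1 p.2.1 p.2.2 :=
  S.measurable_hEnergy.sqrt.ennreal_ofReal

lemma weight_rpow {k : ℝ} (hk : 0 ≤ k) (t : ℝ) (x v : E3) :
    S.weight t x v ^ k = ENNReal.ofReal (hEnergy S.f S.ξ S.η t x v ^ (k / 2)) := by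
  have h := S.one_le_hEnergy t x v
  rw [weight, ENNReal.ofReal_rpow_of_nonneg (Real.sqrt_nonneg _) hk, Real.sqrt_eq_rpow,
    ← Real.rpow_mul (by linarith)]
  congr 2
  ring

lemma volume_weight_comp_le (t : ℝ) (X V : E3 → E3)
    (hV : ∀ v v', ‖v - v'‖ ≤ 2 * ‖V v - V v'‖) {r : ℝ} (hr : 0 < r) :
    volume {v | S.weight t (X v) (V v) ≤ ENNReal.ofReal r}
      ≤ ENNReal.ofReal 512 * volume (Metric.ball (0 : E3) 1) * ENNReal.ofReal (r ^ (3 : ℝ)) := by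
  rcases eq_empty_or_nonempty {v | S.weight t (X v) (V v) ≤ ENNReal.ofReal r} with he | ⟨v', hv'⟩
  · rw [he]; simp
  have hb : ∀ v, S.weight t (X v) (V v) ≤ ENNReal.ofReal r → ‖V v - S.η t‖ ≤ 2 * r := by
    intro v hv
    have h1 := S.relEnergy_add_one_le_hEnergy t (X v) (V v)
    rw [weight, ENNReal.ofReal_le_ofReal_iff hr.le, Real.sqrt_le_left hr.le] at hv
    have h2 : 0 ≤ ‖X v - S.ξ t‖⁻¹ := by positivity
    have h3 : ‖V v - S.η t‖ ^ 2 ≤ (2 * r) ^ 2 := by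
      simp only [relEnergy] at h1
      nlinarith [sq_nonneg r]
    exact le_of_sq_le_sq h3 (by positivity)
  have hsub : {v | S.weight t (X v) (V v) ≤ ENNReal.ofReal r} ⊆ Metric.closedBall v' (8 * r) := by
    intro v hv
    rw [mem_closedBall_iff_norm]
    have h1 := norm_sub_le_norm_sub_add_norm_sub (V v) (S.η t) (V v')
    rw [norm_sub_rev (S.η t)] at h1
    linarith [hV v v', hb v hv, hb v' hv']
  refine (measure_mono hsub).trans (le_of_eq ?_)
  rw [Measure.addHaar_closedBall _ _ (by positivity), mul_right_comm,
    ← ENNReal.ofReal_mul (by norm_num)]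
  congr 2
  have : Module.finrank ℝ E3 = 3 := by simp
  rw [this, show (3 : ℝ) = ((3 : ℕ) : ℝ) by norm_num, Real.rpow_natCast]
  ring

lemma f_eq_zero_at_charge {t : ℝ} (ht : t ∈ Icc 0 T) (v : E3) : S.f t (S.ξ t) v = 0 := by
  obtain ⟨B, -, hB⟩ := S.exists_relEnergy_le
  by_contra h
  exact (hB t ht _ _ h).1 rfl

lemma enorm_inv_mul_le_weight_mul {t : ℝ} (ht : t ∈ Icc 0 T) (x v : E3) :
    ‖x - S.ξ t‖ₑ⁻¹ * ENNReal.ofReal (S.f t x v)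
      ≤ S.weight t x v ^ (2 : ℝ) * ENNReal.ofReal (S.f t x v) := by
  rcases eq_or_ne x (S.ξ t) with rfl | hx
  · simp [S.f_eq_zero_at_charge ht]
  gcongr
  have h := enorm_inv_rpow_eq_ofReal (sub_ne_zero.2 hx) 1
  rw [ENNReal.rpow_one, Real.rpow_neg_one] at h
  rw [h, S.weight_rpow (by norm_num)]
  refine ENNReal.ofReal_le_ofReal ?_
  have h1 := S.relEnergy_add_one_le_hEnergy t x v
  have h2 : 0 ≤ ‖v - S.η t‖ ^ 2 / 2 := by positivity
  simp only [relEnergy] at h1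
  norm_num
  linarith

lemma exists_hEnergy_rpow_mul_le {k : ℝ} (hk : 0 ≤ k) : ∃ B : ℝ, ∀ t ∈ Icc 0 T, ∀ x v,
    hEnergy S.f S.ξ S.η t x v ^ (k / 2) * S.f t x v ≤ B * S.f t x v := by
  obtain ⟨B, hB0, hB⟩ := S.exists_relEnergy_le
  refine ⟨(B + (energy S.f S.ξ S.η 0 + (mass S.f 0)⁻¹ + 1)) ^ (k / 2), fun t ht x v => ?_⟩
  rcases eq_or_ne (S.f t x v) 0 with h | h
  · simp [h]
  have := (hB t ht x v h).2
  have h1 := S.one_le_hEnergy t x v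
  refine mul_le_mul_of_nonneg_right ?_ (S.f_nonneg _ _ _)
  refine Real.rpow_le_rpow (by linarith) ?_ (by positivity)
  rw [S.hEnergy_eq]
  linarith

lemma lintegral_weight_rpow_mul_le {k : ℝ} (hk : 0 ≤ k) {τ t : ℝ} (hτ : τ ∈ Icc 0 t) (htT : t ≤ T) :
    ∫⁻ p : E3 × E3, S.weight τ p.1 p.2 ^ k * ENNReal.ofReal (S.f τ p.1 p.2)
      ≤ ENNReal.ofReal (Hmom S.f S.ξ S.η k t) := by
  obtain ⟨B, hB⟩ := S.exists_hEnergy_rpow_mul_le hk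
  have hnn : ∀ s x v, 0 ≤ hEnergy S.f S.ξ S.η s x v ^ (k / 2) * S.f s x v := fun s x v =>
    mul_nonneg (Real.rpow_nonneg (by linarith [S.one_le_hEnergy s x v]) _) (S.f_nonneg _ _ _)
  have hm : ∀ s : ℝ, Measurable fun p : E3 × E3 =>
      hEnergy S.f S.ξ S.η s p.1 p.2 ^ (k / 2) * S.f s p.1 p.2 := fun s =>
    ((S.measurable_hEnergy.comp (measurable_const.prodMk measurable_id)).pow_const _).mul
      (S.continuous_f_time s).measurable
  have hintg : ∀ s ∈ Icc 0 T, Integrable fun p : E3 × E3 =>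
      hEnergy S.f S.ξ S.η s p.1 p.2 ^ (k / 2) * S.f s p.1 p.2 := fun s hs => by
    refine ((S.integrable_f_time s).const_mul B).mono' (hm s).aestronglyMeasurable
      (Eventually.of_forall fun p => ?_)
    rw [Real.norm_of_nonneg (hnn _ _ _)]
    exact hB s hs _ _
  have hbdd : BddAbove (Htilde S.f S.ξ S.η k '' Icc 0 t) := by
    refine ⟨max B 0 * mass S.f 0, ?_⟩
    rintro _ ⟨s, hs, rfl⟩
    have hs' : s ∈ Icc 0 T := ⟨hs.1, hs.2.trans htT⟩
    calc Htilde S.f S.ξ S.η k s ≤ ∫ p : E3 × E3, max B 0 * S.f s p.1 p.2 :=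
          integral_mono (hintg s hs') ((S.integrable_f_time s).const_mul _) fun p =>
            (hB s hs' _ _).trans
              (mul_le_mul_of_nonneg_right (le_max_left _ _) (S.f_nonneg _ _ _))
      _ = max B 0 * mass S.f s := integral_const_mul _ _
      _ ≤ _ := mul_le_mul_of_nonneg_left (S.mass_le hs') (le_max_right _ _)
  have h1 : Htilde S.f S.ξ S.η k τ ≤ Hmom S.f S.ξ S.η k t := le_csSup hbdd ⟨τ, hτ, rfl⟩
  refine le_trans (le_of_eq ?_) (ENNReal.ofReal_le_ofReal h1)
  rw [Htilde, ofReal_integral_eq_lintegral_ofReal (hintg τ ⟨hτ.1, hτ.2.trans htT⟩)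
    (Eventually.of_forall fun p => hnn _ _ _)]
  refine lintegral_congr fun p => ?_
  rw [S.weight_rpow hk, ENNReal.ofReal_mul
    (Real.rpow_nonneg (by linarith [S.one_le_hEnergy τ p.1 p.2]) _)]

end VPClassicalSolution

lemma CutoffData.continuous_chiR (T : ℝ) (f : ℝ → E3 → E3 → ℝ) (c : CutoffData) :
    Continuous (chiR T f c) :=
  c.smooth.continuous.comp (by fun_prop)

namespace VPClassicalSolution

variable {T : ℝ} (S : VPClassicalSolution T)

lemma Rcut_pos (c : CutoffData) : 0 < Rcut T S.f c.K0 := by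
  have h1 := S.mass_nonneg 0
  have h2 := S.T_pos
  have h3 := c.K0_ge
  unfold Rcut
  positivity

lemma Rcut_pow_three_ge (c : CutoffData) : 2400 * (1 + mass S.f 0) ≤ Rcut T S.f c.K0 ^ 3 := by
  have h1 := S.mass_nonneg 0
  have h2 := S.T_pos
  have h3 := c.K0_ge
  have h4 : 0 ≤ 24 * c.K0 * (1 + mass S.f 0) := by positivity
  have e : ((24 * c.K0 * (1 + mass S.f 0)) ^ ((1 : ℝ) / 3)) ^ 3 = 24 * c.K0 * (1 + mass S.f 0) := by
    rw [← Real.rpow_natCast, ← Real.rpow_mul h4]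
    norm_num
  rw [Rcut, mul_pow, e]
  have h5 : 1 ≤ (1 + T) ^ 3 := one_le_pow₀ (by linarith)
  calc 2400 * (1 + mass S.f 0) = (24 * 100) * (1 + mass S.f 0) * 1 := by ring
    _ ≤ 24 * c.K0 * (1 + mass S.f 0) * (1 + T) ^ 3 := by gcongr

lemma integrable_coulomb {t : ℝ} (ht : t ∈ Icc 0 T) (x : E3) :
    Integrable fun y : E3 => (rho S.f t y / ‖x - y‖ ^ 3) • (x - y) := by
  obtain ⟨C, hC, h⟩ := S.exists_lintegral_coulomb_le
  have hρ : Measurable fun y => rho S.f t y :=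
    S.measurable_rho.comp (measurable_const.prodMk measurable_id)
  refine ⟨((hρ.div (by fun_prop)).smul (by fun_prop)).aestronglyMeasurable, ?_⟩
  refine lt_of_le_of_lt (lintegral_mono fun y => ?_) ((h t ht x).trans_lt hC.lt_top)
  exact enorm_coulomb_le (S.rho_nonneg t y) _

lemma integrable_coulomb_cutoff (c : CutoffData) {t : ℝ} (ht : t ∈ Icc 0 T) (x : E3) :
    Integrable fun y : E3 => (chiR T S.f c (x - y) * rho S.f t y / ‖x - y‖ ^ 3) • (x - y) := by
  have hc : Continuous (chiR T S.f c) := c.continuous_chiR T S.f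
  have hφ : Continuous fun y => chiR T S.f c (x - y) := hc.comp (by fun_prop)
  have h := (S.integrable_coulomb ht x).bdd_smul (C := 1) hφ.aestronglyMeasurable
    (Eventually.of_forall fun y => by
      have := c.mem_Icc ((Rcut T S.f c.K0)⁻¹ • (x - y))
      exact (Real.norm_of_nonneg this.1).trans_le this.2)
  refine h.congr (Eventually.of_forall fun y => ?_)
  simp only [mul_div_assoc, Pi.smul_apply', smul_smul]

lemma norm_Eext_sub_le (c : CutoffData) {t : ℝ} (ht : t ∈ Icc 0 T) (x x' : E3) :
    ‖Eext T S.f c t x - Eext T S.f c t x'‖ ≤ 6 / Rcut T S.f c.K0 ^ 3 * mass S.f 0 * ‖x - x'‖ := by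
  have hR := S.Rcut_pos c
  set K : E3 → E3 := fun z => ((1 - c.χ ((Rcut T S.f c.K0)⁻¹ • z)) * (‖z‖ ^ 3)⁻¹) • z with hK
  have key : ∀ x, Integrable (fun y => rho S.f t y • K (x - y)) ∧
      Eext T S.f c t x = ∫ y, rho S.f t y • K (x - y) := by
    intro x
    have e : ∀ y, (rho S.f t y / ‖x - y‖ ^ 3) • (x - y)
        - (chiR T S.f c (x - y) * rho S.f t y / ‖x - y‖ ^ 3) • (x - y)
        = rho S.f t y • K (x - y) := by
      intro y
      simp only [hK, chiR, smul_smul, ← sub_smul]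
      congr 1
      ring
    have hi := (S.integrable_coulomb ht x).sub (S.integrable_coulomb_cutoff c ht x)
    refine ⟨hi.congr (Eventually.of_forall e), ?_⟩
    rw [Eext, Efield, Eint, ← integral_sub (S.integrable_coulomb ht x)
      (S.integrable_coulomb_cutoff c ht x)]
    exact integral_congr_ae (Eventually.of_forall e)
  have hρi : Integrable fun y => rho S.f t y := by
    have hρ : Measurable fun y => rho S.f t y :=
      S.measurable_rho.comp (measurable_const.prodMk measurable_id)
    refine ⟨hρ.aestronglyMeasurable, ?_⟩
    rw [hasFiniteIntegral_iff_ofReal (Eventually.of_forall fun y => S.rho_nonneg t y),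
      S.lintegral_rho]
    exact ENNReal.ofReal_lt_top
  have hmass : ∫ y, rho S.f t y = mass S.f t := by
    rw [integral_eq_lintegral_of_nonneg_ae (Eventually.of_forall fun y => S.rho_nonneg t y)
      hρi.aestronglyMeasurable, S.lintegral_rho, ENNReal.toReal_ofReal (S.mass_nonneg t)]
  rw [(key x).2, (key x').2, ← integral_sub (key x).1 (key x').1]
  calc ‖∫ y, (rho S.f t y • K (x - y) - rho S.f t y • K (x' - y))‖
      ≤ ∫ y, rho S.f t y * (6 / Rcut T S.f c.K0 ^ 3 * ‖x - x'‖) := by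
        refine norm_integral_le_of_norm_le (hρi.mul_const _) (Eventually.of_forall fun y => ?_)
        rw [← smul_sub, norm_smul, Real.norm_of_nonneg (S.rho_nonneg t y)]
        refine mul_le_mul_of_nonneg_left ?_ (S.rho_nonneg t y)
        have := c.norm_rescaled_exterior_kernel_sub_le hR (x - y) (x' - y)
        rwa [sub_sub_sub_cancel_right] at this
    _ = mass S.f t * (6 / Rcut T S.f c.K0 ^ 3 * ‖x - x'‖) := by
        rw [integral_mul_const, hmass]
    _ ≤ mass S.f 0 * (6 / Rcut T S.f c.K0 ^ 3 * ‖x - x'‖) := by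
        gcongr
        exact S.mass_le ht
    _ = _ := by ring

lemma norm_Fext_sub_le (c : CutoffData) (t : ℝ) (x x' : E3) :
    ‖Fext T S.f S.ξ c t x - Fext T S.f S.ξ c t x'‖ ≤ 6 / Rcut T S.f c.K0 ^ 3 * ‖x - x'‖ := by
  have key : ∀ x, Fext T S.f S.ξ c t x
      = ((1 - c.χ ((Rcut T S.f c.K0)⁻¹ • (x - S.ξ t))) * (‖x - S.ξ t‖ ^ 3)⁻¹) • (x - S.ξ t) := by
    intro x
    rw [Fext, Fint, Fpt, chiR, smul_smul, ← sub_smul]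
    congr 1
    ring
  have := c.norm_rescaled_exterior_kernel_sub_le (S.Rcut_pos c) (x - S.ξ t) (x' - S.ξ t)
  rw [sub_sub_sub_cancel_right] at this
  rwa [key, key]

/-- The exterior field is Lipschitz with a small constant. -/
lemma norm_exterior_field_sub_le (c : CutoffData) {t : ℝ} (ht : t ∈ Icc 0 T) (x x' : E3) :
    ‖(Eext T S.f c t x + Fext T S.f S.ξ c t x) - (Eext T S.f c t x' + Fext T S.f S.ξ c t x')‖
      ≤ 1 / 400 * ‖x - x'‖ := by
  rw [add_sub_add_comm]
  refine (norm_add_le _ _).trans ?_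
  refine (add_le_add (S.norm_Eext_sub_le c ht x x') (S.norm_Fext_sub_le c t x x')).trans ?_
  have hR := S.Rcut_pos c
  have h : 6 / Rcut T S.f c.K0 ^ 3 * (1 + mass S.f 0) ≤ 1 / 400 := by
    rw [div_mul_eq_mul_div, div_le_iff₀ (by positivity)]
    linarith [S.Rcut_pow_three_ge c]
  calc _ = 6 / Rcut T S.f c.K0 ^ 3 * (1 + mass S.f 0) * ‖x - x'‖ := by ring
    _ ≤ _ := by gcongr

end VPClassicalSolution

namespace BackwardFlow

variable {T : ℝ} {S : VPClassicalSolution T} {c : CutoffData} {t : ℝ} (Φ : BackwardFlow T S c t)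

/-- The phase space map of the flow at time `s`. -/
def map (s : ℝ) (p : E3 × E3) : E3 × E3 := (Φ.X s p.1 p.2, Φ.V s p.1 p.2)

lemma map_zero (p : E3 × E3) : Φ.map 0 p = p := by
  simp [map, Φ.init_X, Φ.init_V]

lemma hasDerivAt_map (p : E3 × E3) {s : ℝ} (hs : s ∈ Icc 0 t) :
    HasDerivAt (fun s => Φ.map s p) (-(Φ.map s p).2,
      -(Eext T S.f c (t - s) (Φ.map s p).1 + Fext T S.f S.ξ c (t - s) (Φ.map s p).1)) s :=
  (Φ.ode_X p.1 p.2 s hs).prodMk (Φ.ode_V p.1 p.2 s hs)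

lemma norm_map_sub_le (ht : t ∈ Icc 0 (min 1 T)) {s : ℝ} (hs : s ∈ Icc 0 t) (p q : E3 × E3) :
    ‖Φ.map s p - Φ.map s q‖ ≤ 3 * ‖p - q‖ := by
  have ht1 : t ≤ 1 := ht.2.trans (min_le_left _ _)
  have htT : t ≤ T := ht.2.trans (min_le_right _ _)
  have h := dist_le_of_trajectories_ODE_of_mem (K := 1) (s := fun _ => univ)
    (v := fun s (y : E3 × E3) => (-y.2,
      -(Eext T S.f c (t - s) y.1 + Fext T S.f S.ξ c (t - s) y.1)))
    (f := fun s => Φ.map s p) (g := fun s => Φ.map s q) (a := 0) (b := t) (δ := ‖p - q‖)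
    (fun s hs => LipschitzOnWith.of_dist_le_mul fun y _ z _ => by
      rw [NNReal.coe_one, one_mul, dist_eq_norm, dist_eq_norm, Prod.norm_def, Prod.norm_def]
      have h1 := S.norm_exterior_field_sub_le c (t := t - s)
        ⟨by linarith [hs.2], by linarith [hs.1]⟩ z.1 y.1
      simp only [Prod.fst_sub, Prod.snd_sub]
      refine max_le ?_ ?_
      · rw [neg_sub_neg, norm_sub_rev]; exact le_max_right _ _
      · rw [neg_sub_neg]
        refine h1.trans (le_trans ?_ (le_max_left _ _))
        rw [norm_sub_rev]
        linarith [norm_nonneg (y.1 - z.1)])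
    (fun s hs => (Φ.hasDerivAt_map p hs).continuousAt.continuousWithinAt)
    (fun s hs => (Φ.hasDerivAt_map p (Ico_subset_Icc_self hs)).hasDerivWithinAt)
    (fun _ _ => mem_univ _)
    (fun s hs => (Φ.hasDerivAt_map q hs).continuousAt.continuousWithinAt)
    (fun s hs => (Φ.hasDerivAt_map q (Ico_subset_Icc_self hs)).hasDerivWithinAt)
    (fun _ _ => mem_univ _) (by rw [Φ.map_zero, Φ.map_zero, dist_eq_norm]) s hs
  rw [dist_eq_norm] at h
  refine h.trans ?_
  rw [mul_comm]
  gcongr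
  calc Real.exp ((1 : NNReal) * (s - 0)) ≤ Real.exp 1 := by
        refine Real.exp_le_exp.2 ?_
        simpa using hs.2.trans ht1
    _ ≤ 3 := Real.exp_one_lt_three.le

lemma norm_snd_sub_sub_le (ht : t ∈ Icc 0 (min 1 T)) {s : ℝ} (hs : s ∈ Icc 0 t) (p q : E3 × E3) :
    ‖((Φ.map s p).2 - (Φ.map s q).2) - (p.2 - q.2)‖ ≤ 3 / 400 * ‖p - q‖ * s := by
  have htT : t ≤ T := ht.2.trans (min_le_right _ _)
  have h := norm_image_sub_le_of_norm_deriv_le_segment' (a := 0) (b := t)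
    (f := fun s => (Φ.map s p).2 - (Φ.map s q).2) (C := 3 / 400 * ‖p - q‖)
    (fun s hs => ((Φ.ode_V p.1 p.2 s hs).sub (Φ.ode_V q.1 q.2 s hs)).hasDerivWithinAt)
    (fun s hs => by
      rw [neg_sub_neg]
      have h1 := S.norm_exterior_field_sub_le c (t := t - s)
        ⟨by linarith [hs.2], by linarith [hs.1]⟩ (Φ.X s q.1 q.2) (Φ.X s p.1 p.2)
      have h2 := Φ.norm_map_sub_le ht (Ico_subset_Icc_self hs) q p
      have h3 := (norm_fst_le (Φ.map s q - Φ.map s p)).trans h2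
      rw [norm_sub_rev q p] at h3
      refine h1.trans ?_
      have h4 : ‖Φ.X s q.1 q.2 - Φ.X s p.1 p.2‖ ≤ 3 * ‖p - q‖ := h3
      linarith) s hs
  simpa [Φ.map_zero] using h

lemma norm_fst_sub_sub_le (ht : t ∈ Icc 0 (min 1 T)) {s : ℝ} (hs : s ∈ Icc 0 t) (p q : E3 × E3) :
    ‖((Φ.map s p).1 - (Φ.map s q).1) + s • (p.2 - q.2) - (p.1 - q.1)‖ ≤ 3 / 400 * ‖p - q‖ * s := by
  have ht1 : t ≤ 1 := ht.2.trans (min_le_left _ _)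
  have h := norm_image_sub_le_of_norm_deriv_le_segment' (a := 0) (b := t)
    (f := fun s => (Φ.map s p).1 - (Φ.map s q).1 + s • (p.2 - q.2)) (C := 3 / 400 * ‖p - q‖)
    (fun s hs => (((Φ.ode_X p.1 p.2 s hs).sub (Φ.ode_X q.1 q.2 s hs)).add
      ((hasDerivAt_id s).smul_const (p.2 - q.2))).hasDerivWithinAt)
    (fun s hs => by
      have h1 := Φ.norm_snd_sub_sub_le ht (Ico_subset_Icc_self hs) p q
      have h2 : -Φ.V s p.1 p.2 - -Φ.V s q.1 q.2 + (1 : ℝ) • (p.2 - q.2)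
        = -(((Φ.map s p).2 - (Φ.map s q).2) - (p.2 - q.2)) := by
        simp only [map]
        module
      rw [h2, norm_neg]
      refine h1.trans ?_
      exact mul_le_of_le_one_right (by positivity) (hs.2.le.trans ht1)) s hs
  simpa [Φ.map_zero] using h

lemma norm_sub_le_norm_map_sub (ht : t ∈ Icc 0 (min 1 T)) {s : ℝ} (hs : s ∈ Icc 0 t)
    (p q : E3 × E3) : ‖p - q‖ ≤ 3 * ‖Φ.map s p - Φ.map s q‖ := by
  have hs1 : s ≤ 1 := hs.2.trans (ht.2.trans (min_le_left _ _))
  have hs0 := hs.1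
  have h1 := Φ.norm_snd_sub_sub_le ht hs p q
  have h2 := Φ.norm_fst_sub_sub_le ht hs p q
  have hN := norm_nonneg (p - q)
  have h3 : 3 / 400 * ‖p - q‖ * s ≤ 3 / 400 * ‖p - q‖ := mul_le_of_le_one_right (by positivity) hs1
  have h4 := norm_fst_le (Φ.map s p - Φ.map s q)
  have h5 := norm_snd_le (Φ.map s p - Φ.map s q)
  simp only [Prod.fst_sub, Prod.snd_sub] at h4 h5
  have h6 := norm_le_norm_add_norm_sub ((Φ.map s p).2 - (Φ.map s q).2) (p.2 - q.2)
  have h7 := norm_le_norm_add_norm_sub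
    ((Φ.map s p).1 - (Φ.map s q).1 + s • (p.2 - q.2)) (p.1 - q.1)
  have h8 := norm_add_le ((Φ.map s p).1 - (Φ.map s q).1) (s • (p.2 - q.2))
  have h9 : ‖s • (p.2 - q.2)‖ ≤ ‖p.2 - q.2‖ := by
    rw [norm_smul, Real.norm_of_nonneg hs0]
    exact mul_le_of_le_one_left (norm_nonneg _) hs1
  have h10 : ‖p - q‖ ≤ max ‖p.1 - q.1‖ ‖p.2 - q.2‖ := by
    rw [Prod.norm_def, Prod.fst_sub, Prod.snd_sub]
  have h11 : max ‖p.1 - q.1‖ ‖p.2 - q.2‖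
      ≤ 2 * ‖Φ.map s p - Φ.map s q‖ + 6 / 400 * ‖p - q‖ := by
    refine max_le ?_ ?_ <;> linarith [norm_nonneg (Φ.map s p - Φ.map s q)]
  linarith

lemma norm_sub_le_norm_V_sub (ht : t ∈ Icc 0 (min 1 T)) {s : ℝ} (hs : s ∈ Icc 0 t)
    (x v v' : E3) : ‖v - v'‖ ≤ 2 * ‖Φ.V s x v - Φ.V s x v'‖ := by
  have hs1 : s ≤ 1 := hs.2.trans (ht.2.trans (min_le_left _ _))
  have h1 := Φ.norm_snd_sub_sub_le ht hs (x, v) (x, v')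
  simp only [map, Prod.mk_sub_mk, sub_self, Prod.norm_mk, norm_zero] at h1
  rw [max_eq_right (norm_nonneg _)] at h1
  have h3 : 3 / 400 * ‖v - v'‖ * s ≤ 3 / 400 * ‖v - v'‖ := mul_le_of_le_one_right (by positivity) hs1
  have h6 := norm_le_norm_add_norm_sub (Φ.V s x v - Φ.V s x v') (v - v')
  linarith [norm_nonneg (v - v')]

lemma mul_norm_sub_le_norm_X_sub (ht : t ∈ Icc 0 (min 1 T)) {s : ℝ} (hs : s ∈ Icc 0 t)
    (x v v' : E3) : s * ‖v - v'‖ ≤ 2 * ‖Φ.X s x v - Φ.X s x v'‖ := by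
  have h1 := Φ.norm_fst_sub_sub_le ht hs (x, v) (x, v')
  simp only [map, Prod.mk_sub_mk, sub_self, Prod.norm_mk, norm_zero, sub_zero] at h1
  rw [max_eq_right (norm_nonneg _)] at h1
  have h6 := norm_le_norm_add_norm_sub (Φ.X s x v - Φ.X s x v') (-(s • (v - v')))
  rw [norm_neg, norm_smul, Real.norm_of_nonneg hs.1, sub_neg_eq_add] at h6
  nlinarith [mul_nonneg hs.1 (norm_nonneg (v - v'))]

lemma continuous_X (ht : t ∈ Icc 0 (min 1 T)) {s : ℝ} (hs : s ∈ Icc 0 t) (x : E3) :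
    Continuous fun v => Φ.X s x v := by
  have h : LipschitzWith 3 (Φ.map s) := LipschitzWith.of_dist_le_mul fun p q => by
    rw [dist_eq_norm, dist_eq_norm]; exact Φ.norm_map_sub_le ht hs p q
  exact continuous_fst.comp (h.continuous.comp (by fun_prop : Continuous fun v : E3 => (x, v)))

lemma exists_norm_sub_le (ht : t ∈ Icc 0 (min 1 T)) {s : ℝ} (hs : s ∈ Icc 0 t) (hs0 : 0 < s)
    (x y : E3) : ∃ v₀, ∀ v, ‖v - v₀‖ ≤ 4 / s * ‖Φ.X s x v - y‖ := by
  have hc : Continuous fun v => ‖Φ.X s x v - y‖ := ((Φ.continuous_X ht hs x).sub continuous_const).norm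
  have hlim : Tendsto (fun v => ‖Φ.X s x v - y‖) (cocompact E3) atTop := by
    have h1 : Tendsto (fun v : E3 => s / 2 * ‖v‖ - ‖Φ.X s x 0 - y‖) (cocompact E3) atTop :=
      tendsto_atTop_add_const_right _ _
        ((tendsto_norm_cocompact_atTop (E := E3)).const_mul_atTop (by positivity))
    refine tendsto_atTop_mono (fun v => ?_) h1
    have h2 := Φ.mul_norm_sub_le_norm_X_sub ht hs x v 0
    rw [sub_zero] at h2
    have h3 := norm_sub_le_norm_sub_add_norm_sub (Φ.X s x v) y (Φ.X s x 0)
    rw [norm_sub_rev y] at h3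
    linarith
  obtain ⟨v₀, hv₀⟩ := hc.exists_forall_le hlim
  refine ⟨v₀, fun v => ?_⟩
  have h2 := Φ.mul_norm_sub_le_norm_X_sub ht hs x v v₀
  have h3 := norm_sub_le_norm_sub_add_norm_sub (Φ.X s x v) y (Φ.X s x v₀)
  rw [norm_sub_rev y] at h3
  rw [div_mul_eq_mul_div, le_div_iff₀ hs0]
  linarith [hv₀ v]

lemma antilipschitzWith_map (ht : t ∈ Icc 0 (min 1 T)) {s : ℝ} (hs : s ∈ Icc 0 t) :
    AntilipschitzWith 3 (Φ.map s) :=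
  AntilipschitzWith.of_le_mul_dist fun p q => by
    rw [dist_eq_norm, dist_eq_norm]; exact Φ.norm_sub_le_norm_map_sub ht hs p q

/-- The flow with time truncated to `[0, t]` is jointly continuous. -/
lemma continuous_map_projIcc (ht : t ∈ Icc 0 (min 1 T)) :
    Continuous fun q : ℝ × E3 × E3 => Φ.map (projIcc 0 t ht.1 q.1) q.2 := by
  refine continuous_prod_of_continuous_lipschitzWith' _ 3 (fun s => ?_) (fun p => ?_)
  · exact LipschitzWith.of_dist_le_mul fun p q => by
      rw [dist_eq_norm, dist_eq_norm]; exact Φ.norm_map_sub_le ht (projIcc 0 t ht.1 s).2 p q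
  · have h1 : ContinuousOn (fun s => Φ.map s p) (Icc 0 t) := fun s hs =>
      (Φ.hasDerivAt_map p hs).continuousAt.continuousWithinAt
    exact h1.domRestrict.comp continuous_projIcc

end BackwardFlow

/-- The constant in the interpolation inequality between velocity moments of a density bounded
by `F`. -/
def momentConst (F : ℝ) : ℝ≥0∞ :=
  2 * (ENNReal.ofReal F * (ENNReal.ofReal 512 * volume (Metric.ball (0 : E3) 1)) + 1)

lemma momentConst_ne_top (F : ℝ) : momentConst F ≠ ⊤ := by
  have : volume (Metric.ball (0 : E3) 1) ≠ ⊤ := measure_ball_lt_top.ne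
  unfold momentConst
  finiteness

lemma VPClassicalSolution.measurable_weight_time {T : ℝ} (S : VPClassicalSolution T) (t : ℝ) :
    Measurable fun p : E3 × E3 => S.weight t p.1 p.2 := by
  have h : Measurable fun p : E3 × E3 => (t, p) := measurable_prodMk_left
  have h2 := S.measurable_weight.comp h
  exact h2

namespace BackwardFlow

variable {T : ℝ} {S : VPClassicalSolution T} {c : CutoffData} {t : ℝ} (Φ : BackwardFlow T S c t)

/-- The density transported by the backward flow. -/
def density (s : ℝ) (x v : E3) : ℝ≥0∞ := ENNReal.ofReal (S.f (t - s) (Φ.X s x v) (Φ.V s x v))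

/-- Moments of the density in the velocity variable along the backward flow. -/
def moment (k s : ℝ) (x : E3) : ℝ≥0∞ :=
  ∫⁻ v, S.weight (t - s) (Φ.X s x v) (Φ.V s x v) ^ k * Φ.density s x v

lemma continuous_map (ht : t ∈ Icc 0 (min 1 T)) {s : ℝ} (hs : s ∈ Icc 0 t) :
    Continuous (Φ.map s) :=
  (LipschitzWith.of_dist_le_mul (K := 3) fun p q => by
    rw [dist_eq_norm, dist_eq_norm]; exact Φ.norm_map_sub_le ht hs p q).continuous

lemma measurable_weight_map (ht : t ∈ Icc 0 (min 1 T)) {s : ℝ} (hs : s ∈ Icc 0 t) :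
    Measurable fun p : E3 × E3 => S.weight (t - s) (Φ.X s p.1 p.2) (Φ.V s p.1 p.2) := by
  have h := (S.measurable_weight_time (t - s)).comp (Φ.continuous_map ht hs).measurable
  exact h

lemma measurable_density (ht : t ∈ Icc 0 (min 1 T)) {s : ℝ} (hs : s ∈ Icc 0 t) :
    Measurable fun p : E3 × E3 => Φ.density s p.1 p.2 :=
  (S.continuous_f.measurable.comp
    (measurable_const.prodMk (Φ.continuous_map ht hs).measurable)).ennreal_ofReal

lemma measurable_density_velocity (ht : t ∈ Icc 0 (min 1 T)) {s : ℝ} (hs : s ∈ Icc 0 t) (x : E3) :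
    Measurable (Φ.density s x) :=
  (Φ.measurable_density ht hs).comp (measurable_const.prodMk measurable_id)

lemma measurable_weight_velocity (ht : t ∈ Icc 0 (min 1 T)) {s : ℝ} (hs : s ∈ Icc 0 t) (x : E3) :
    Measurable fun v => S.weight (t - s) (Φ.X s x v) (Φ.V s x v) := by
  have h : Measurable fun v : E3 => (x, v) := measurable_prodMk_left
  have h2 := (Φ.measurable_weight_map ht hs).comp h
  exact h2

lemma measurable_moment (ht : t ∈ Icc 0 (min 1 T)) {s : ℝ} (hs : s ∈ Icc 0 t) (k : ℝ) :
    Measurable (Φ.moment k s) :=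
  (((Φ.measurable_weight_map ht hs).pow_const k).mul
    (Φ.measurable_density ht hs)).lintegral_prod_right'

lemma sub_mem_Icc (ht : t ∈ Icc 0 (min 1 T)) {s : ℝ} (hs : s ∈ Icc 0 t) : t - s ∈ Icc 0 T :=
  ⟨sub_nonneg.2 hs.2, by linarith [hs.1, ht.2.trans (min_le_right 1 T)]⟩

lemma density_le (ht : t ∈ Icc 0 (min 1 T)) {s : ℝ} (hs : s ∈ Icc 0 t) (x v : E3) :
    Φ.density s x v ≤ ENNReal.ofReal (supf0 S.f) :=
  ENNReal.ofReal_le_ofReal (S.f_le_supf0 (sub_mem_Icc ht hs) _ _)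

lemma moment_zero (s : ℝ) (x : E3) : Φ.moment 0 s x = ∫⁻ v, Φ.density s x v := by
  simp [moment]

lemma moment_le_rpow (ht : t ∈ Icc 0 (min 1 T)) {s : ℝ} (hs : s ∈ Icc 0 t) {j k : ℝ} (hj : 0 ≤ j)
    (hjk : j < k) (x : E3) :
    Φ.moment j s x ≤ momentConst (supf0 S.f) * Φ.moment k s x ^ ((j + 3) / (k + 3)) :=
  lintegral_rpow_mul_le_rpow hj hjk ENNReal.ofReal_ne_top
    (by have : volume (Metric.ball (0 : E3) 1) ≠ ⊤ := measure_ball_lt_top.ne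
        finiteness)
    (Φ.density_le ht hs x) (Φ.measurable_weight_velocity ht hs x)
    (fun _ hr => S.volume_weight_comp_le _ _ _ (Φ.norm_sub_le_norm_V_sub ht hs x) hr)

lemma lintegral_moment_le (ht : t ∈ Icc 0 (min 1 T)) {s : ℝ} (hs : s ∈ Icc 0 t) (k : ℝ) :
    ∫⁻ x, Φ.moment k s x ≤ 3 ^ 6 *
      ∫⁻ p : E3 × E3, S.weight (t - s) p.1 p.2 ^ k * ENNReal.ofReal (S.f (t - s) p.1 p.2) := by
  have hG : Measurable fun p : E3 × E3 =>
      S.weight (t - s) p.1 p.2 ^ k * ENNReal.ofReal (S.f (t - s) p.1 p.2) :=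
    ((S.measurable_weight_time _).pow_const k).mul
      (S.continuous_f_time _).measurable.ennreal_ofReal
  have : (volume : Measure (E3 × E3)).IsAddHaarMeasure :=
    inferInstanceAs ((volume : Measure E3).prod volume).IsAddHaarMeasure
  have h := (Φ.antilipschitzWith_map ht hs).lintegral_comp_le volume
    (Φ.continuous_map ht hs).measurable hG
  have hf : Module.finrank ℝ (E3 × E3) = 6 := by simp
  have hm := hG.comp (Φ.continuous_map ht hs).measurable
  have e : ∫⁻ x, Φ.moment k s x = ∫⁻ p, S.weight (t - s) (Φ.map s p).1 (Φ.map s p).2 ^ k *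
      ENNReal.ofReal (S.f (t - s) (Φ.map s p).1 (Φ.map s p).2) :=
    (lintegral_prod _ hm.aemeasurable).symm
  rw [hf] at h
  rw [e]
  exact_mod_cast h

/-- Interpolation of the weighted moments of `f` between the mass and a higher moment. -/
lemma _root_.VPClassicalSolution.lintegral_weight_rpow_mul_le_interpolate {j k : ℝ} (hj : 0 < j) (hjk : j < k)
    {τ t : ℝ} (hτ : τ ∈ Icc 0 t) (htT : t ≤ T) :
    ∫⁻ p : E3 × E3, S.weight τ p.1 p.2 ^ j * ENNReal.ofReal (S.f τ p.1 p.2)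
      ≤ ENNReal.ofReal (mass S.f 0) ^ (1 - j / k)
        * ENNReal.ofReal (Hmom S.f S.ξ S.η k t) ^ (j / k) := by
  have hk : 0 < k := hj.trans hjk
  have h1 : 0 < 1 - j / k := sub_pos.2 ((div_lt_one hk).2 hjk)
  have h2 : 0 < j / k := by positivity
  have hfm : Measurable fun p : E3 × E3 => ENNReal.ofReal (S.f τ p.1 p.2) :=
    (S.continuous_f_time _).measurable.ennreal_ofReal
  have hwm : Measurable fun p : E3 × E3 => S.weight τ p.1 p.2 :=
    S.measurable_weight_time τ
  have hm : ∫⁻ p : E3 × E3, ENNReal.ofReal (S.f τ p.1 p.2) ≤ ENNReal.ofReal (mass S.f 0) := by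
    rw [← ofReal_integral_eq_lintegral_ofReal (S.integrable_f_time τ)
      (Eventually.of_forall fun p => S.f_nonneg _ _ _)]
    exact ENNReal.ofReal_le_ofReal (S.mass_le ⟨hτ.1, hτ.2.trans htT⟩)
  calc ∫⁻ p : E3 × E3, S.weight τ p.1 p.2 ^ j * ENNReal.ofReal (S.f τ p.1 p.2)
      = ∫⁻ p : E3 × E3, ENNReal.ofReal (S.f τ p.1 p.2) ^ (1 - j / k) *
          (S.weight τ p.1 p.2 ^ k * ENNReal.ofReal (S.f τ p.1 p.2)) ^ (j / k) := by
        refine lintegral_congr fun p => ?_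
        rw [ENNReal.mul_rpow_of_nonneg _ _ h2.le, ← ENNReal.rpow_mul, mul_div_cancel₀ _ hk.ne',
          mul_left_comm, ← ENNReal.rpow_add_of_nonneg _ _ h1.le h2.le, sub_add_cancel,
          ENNReal.rpow_one]
    _ ≤ (∫⁻ p : E3 × E3, ENNReal.ofReal (S.f τ p.1 p.2)) ^ (1 - j / k) *
          (∫⁻ p : E3 × E3, S.weight τ p.1 p.2 ^ k * ENNReal.ofReal (S.f τ p.1 p.2)) ^ (j / k) :=
        ENNReal.lintegral_mul_norm_pow_le hfm.aemeasurable
          ((hwm.pow_const k).mul hfm).aemeasurable h1.le h2.le (by ring)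
    _ ≤ _ := by
        gcongr
        exact S.lintegral_weight_rpow_mul_le hk.le hτ htT

end BackwardFlow

/-- The contribution of the point charge along the backward flow. -/
lemma exists_lintegral_charge_mul_density_le {p θ : ℝ} (hp : 6 ≤ p) (h0 : 0 < θ) (h1 : θ < 1 / 2)
    (F : ℝ) :
    ∃ C : ℝ≥0∞, C ≠ ⊤ ∧ ∀ {T : ℝ} {S : VPClassicalSolution T} {c : CutoffData} {t : ℝ}
      (Φ : BackwardFlow T S c t), supf0 S.f = F → t ∈ Icc 0 (min 1 T) → ∀ s ∈ Ioc 0 t, ∀ x,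
      ∫⁻ v, (‖Φ.X s x v - S.ξ (t - s)‖ₑ⁻¹) ^ (2 : ℝ) * Φ.density s x v
        ≤ C * ENNReal.ofReal (4 / s) ^ (2 - θ) * Φ.moment (p * (1 + 3 * θ) - 3) s x ^ (1 / p) := by
  obtain ⟨C, hC, h⟩ := exists_lintegral_comp_inv_sq_mul_le h0 h1 (F := ENNReal.ofReal F)
    ENNReal.ofReal_ne_top
  have hL := momentConst_ne_top F
  have h2 : 0 ≤ 1 - 2 * θ := by linarith
  refine ⟨C * (momentConst F ^ ((1 - 2 * θ) / 3) * momentConst F ^ θ), by finiteness,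
    fun {T S c t} Φ hF ht s hs x => ?_⟩
  subst hF
  have hs' : s ∈ Icc 0 t := Ioc_subset_Icc_self hs
  have hs0 : 0 < s := hs.1
  set k := p * (1 + 3 * θ) - 3 with hk
  have hk3 : 3 ≤ k := by nlinarith
  have hk2 : (2 : ℝ) < k := by linarith
  have hm0 := Φ.moment_le_rpow ht hs' le_rfl (by linarith : (0 : ℝ) < k) x
  have hm2 := Φ.moment_le_rpow ht hs' (by norm_num) hk2 x
  rw [Φ.moment_zero] at hm0
  have hU : ∫⁻ v, ‖Φ.X s x v - S.ξ (t - s)‖ₑ⁻¹ * Φ.density s x v ≤ Φ.moment 2 s x :=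
    lintegral_mono fun v => S.enorm_inv_mul_le_weight_mul (BackwardFlow.sub_mem_Icc ht hs') _ _
  calc ∫⁻ v, (‖Φ.X s x v - S.ξ (t - s)‖ₑ⁻¹) ^ (2 : ℝ) * Φ.density s x v
      ≤ C * ENNReal.ofReal (4 / s) ^ (2 - θ) * (∫⁻ v, Φ.density s x v) ^ ((1 - 2 * θ) / 3)
        * (∫⁻ v, ‖Φ.X s x v - S.ξ (t - s)‖ₑ⁻¹ * Φ.density s x v) ^ θ :=
        h _ (Φ.density_le ht hs' x) (Φ.measurable_density_velocity ht hs' x) (Φ.X s x)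
          (Φ.continuous_X ht hs' x).measurable (4 / s) (by positivity)
          (Φ.exists_norm_sub_le ht hs' hs0 x) _
    _ ≤ C * ENNReal.ofReal (4 / s) ^ (2 - θ)
        * (momentConst (supf0 S.f) * Φ.moment k s x ^ ((0 + 3) / (k + 3))) ^ ((1 - 2 * θ) / 3)
        * (momentConst (supf0 S.f) * Φ.moment k s x ^ ((2 + 3) / (k + 3))) ^ θ := by
        gcongr
        exact hU.trans hm2
    _ = C * (momentConst (supf0 S.f) ^ ((1 - 2 * θ) / 3) * momentConst (supf0 S.f) ^ θ)
        * ENNReal.ofReal (4 / s) ^ (2 - θ)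
        * (Φ.moment k s x ^ ((0 + 3) / (k + 3) * ((1 - 2 * θ) / 3))
          * Φ.moment k s x ^ ((2 + 3) / (k + 3) * θ)) := by
        rw [ENNReal.mul_rpow_of_nonneg _ _ (by positivity), ENNReal.mul_rpow_of_nonneg _ _ h0.le,
          ← ENNReal.rpow_mul, ← ENNReal.rpow_mul]
        ring
    _ = _ := by
        have e : (0 + 3) / (k + 3) * ((1 - 2 * θ) / 3) + (2 + 3) / (k + 3) * θ = 1 / p := by
          have : (1 + 3 * θ) ≠ 0 := by positivity
          have : p ≠ 0 := by positivity
          rw [hk, sub_add_cancel]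
          field_simp
          ring
        rw [← e, ENNReal.rpow_add_of_nonneg _ _ (by positivity) (by positivity)]

/-- The contribution of the self-induced field along the backward flow. -/
lemma exists_lintegral_potential_mul_density_le {p θ : ℝ} (hp : 6 ≤ p) (h0 : 0 < θ)
    (h1 : θ < 1 / 2) (F M : ℝ) :
    ∃ C : ℝ≥0∞, C ≠ ⊤ ∧ ∀ {T : ℝ} {S : VPClassicalSolution T} {c : CutoffData} {t : ℝ}
      (Φ : BackwardFlow T S c t), supf0 S.f = F → mass S.f 0 = M → t ∈ Icc 0 (min 1 T) →
      ∀ s ∈ Ioc 0 t, ∀ x,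
      ∫⁻ v, (∫⁻ y, (‖Φ.X s x v - y‖ₑ⁻¹) ^ (2 : ℝ) * ENNReal.ofReal (rho S.f (t - s) y))
          * Φ.density s x v
        ≤ C * ENNReal.ofReal (4 / s) ^ (2 - θ)
          * ENNReal.ofReal (Hmom S.f S.ξ S.η (p * (1 + 2 * θ) - 3) t)
            ^ (θ / (p * (1 + 2 * θ) - 3))
          * Φ.moment (p * (1 + θ) - 3) s x ^ (1 / p) := by
  have hk3 : 3 ≤ p * (1 + 2 * θ) - 3 := by nlinarith
  have hk3' : 3 ≤ p * (1 + θ) - 3 := by nlinarith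
  have hL := momentConst_ne_top F
  obtain ⟨C, hC, h⟩ := exists_lintegral_comp_potential_mul_le h0 h1
    (by linarith : 3 / 2 < p * (1 + 2 * θ) - 3) (F := ENNReal.ofReal F) (A := momentConst F)
    (M := ENNReal.ofReal M) ENNReal.ofReal_ne_top hL ENNReal.ofReal_ne_top
  refine ⟨C * momentConst F ^ ((1 + θ) / 3), by finiteness,
    fun {T S c t} Φ hF hM ht s hs x => ?_⟩
  subst hF hM
  have hs' : s ∈ Icc 0 t := Ioc_subset_Icc_self hs
  have hs0 : 0 < s := hs.1
  have hτ := BackwardFlow.sub_mem_Icc ht hs'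
  set k := p * (1 + 2 * θ) - 3
  have hm0 := Φ.moment_le_rpow ht hs' le_rfl (by linarith : (0 : ℝ) < p * (1 + θ) - 3) x
  rw [Φ.moment_zero] at hm0
  have hw : Measurable fun q : E3 × E3 => S.weight (t - s) q.1 q.2 := S.measurable_weight_time _
  have hf : Measurable fun q : E3 × E3 => ENNReal.ofReal (S.f (t - s) q.1 q.2) :=
    (S.continuous_f_time _).measurable.ennreal_ofReal
  have hρm : Measurable fun y => ENNReal.ofReal (rho S.f (t - s) y) :=
    (S.measurable_rho.comp measurable_prodMk_left).ennreal_ofReal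
  have hN : ∫⁻ y, ∫⁻ v, S.weight (t - s) y v ^ k * ENNReal.ofReal (S.f (t - s) y v)
      ≤ ENNReal.ofReal (Hmom S.f S.ξ S.η k t) := by
    have e := lintegral_prod (μ := (volume : Measure E3)) (ν := (volume : Measure E3)) _
      ((hw.pow_const k).mul hf).aemeasurable
    exact e.symm.trans_le (S.lintegral_weight_rpow_mul_le (by linarith)
      ⟨hτ.1, by linarith⟩ (ht.2.trans (min_le_right _ _)))
  have hdens : ∀ y, ∀ r : ℝ, 0 < r → ENNReal.ofReal (rho S.f (t - s) y)
      ≤ momentConst (supf0 S.f) * (ENNReal.ofReal (r ^ (3 : ℝ))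
        + (∫⁻ v, S.weight (t - s) y v ^ k * ENNReal.ofReal (S.f (t - s) y v))
          * ENNReal.ofReal (r ^ (-k))) := by
    intro y r hr
    have hwy : Measurable fun v => S.weight (t - s) y v := by
      have h2 := hw.comp (measurable_prodMk_left (x := y))
      exact h2
    have h3 := lintegral_rpow_mul_le_scale le_rfl (by linarith : (0 : ℝ) < k)
      (g := fun v => ENNReal.ofReal (S.f (t - s) y v)) (w := fun v => S.weight (t - s) y v)
      (fun v => ENNReal.ofReal_le_ofReal (S.f_le_supf0 hτ y v)) hwy
      (fun r hr => S.volume_weight_comp_le (t - s) (fun _ => y) (fun v => v)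
        (fun v v' => by linarith [norm_nonneg (v - v')]) hr) hr
    simp only [ENNReal.rpow_zero, one_mul, zero_add, sub_zero] at h3
    rw [S.ofReal_rho]
    refine h3.trans ?_
    gcongr
    rw [momentConst, two_mul]
    exact le_self_add
  calc _ ≤ C * ENNReal.ofReal (4 / s) ^ (2 - θ)
        * (∫⁻ y, ∫⁻ v, S.weight (t - s) y v ^ k * ENNReal.ofReal (S.f (t - s) y v)) ^ (θ / k)
        * (∫⁻ v, Φ.density s x v) ^ ((1 + θ) / 3) :=
        h _ (Φ.density_le ht hs' x) (Φ.measurable_density_velocity ht hs' x) (Φ.X s x)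
          (Φ.continuous_X ht hs' x).measurable (4 / s) (by positivity)
          (Φ.exists_norm_sub_le ht hs' hs0 x) _ _ hρm
          (by
            rw [S.lintegral_rho]
            exact ENNReal.ofReal_le_ofReal (S.mass_le hτ)) hdens
    _ ≤ C * ENNReal.ofReal (4 / s) ^ (2 - θ) * ENNReal.ofReal (Hmom S.f S.ξ S.η k t) ^ (θ / k)
        * (momentConst (supf0 S.f)
          * Φ.moment (p * (1 + θ) - 3) s x ^ ((0 + 3) / (p * (1 + θ) - 3 + 3))) ^ ((1 + θ) / 3) := by
        have : 0 ≤ θ / k := div_nonneg h0.le (by linarith)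
        gcongr
    _ = _ := by
        rw [ENNReal.mul_rpow_of_nonneg _ _ (by positivity), ← ENNReal.rpow_mul]
        have e : (0 + 3) / (p * (1 + θ) - 3 + 3) * ((1 + θ) / 3) = 1 / p := by
          have : (1 + θ) ≠ 0 := by positivity
          have : p ≠ 0 := by positivity
          rw [sub_add_cancel]
          field_simp
          ring
        rw [e]
        ring

lemma ofReal_rpow_mul_ofReal_div_rpow_le {s δ θ : ℝ} (hs : 0 < s) (hs1 : s ≤ 1) (hδ : δ ≤ θ)
    (h0 : 0 ≤ θ) :
    ENNReal.ofReal (s ^ (2 - δ)) * ENNReal.ofReal (4 / s) ^ (2 - θ) ≤ 16 := by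
  rw [ENNReal.ofReal_rpow_of_pos (by positivity), ← ENNReal.ofReal_mul (by positivity),
    Real.div_rpow (by norm_num) hs.le]
  have e : s ^ (2 - δ) * (4 ^ (2 - θ) / s ^ (2 - θ)) = 4 ^ (2 - θ) * s ^ (θ - δ) := by
    have : s ^ (2 - δ) = s ^ (2 - θ) * s ^ (θ - δ) := by
      rw [← Real.rpow_add hs]
      congr 1
      ring
    rw [this]
    field_simp
  have h1 : (4 : ℝ) ^ (2 - θ) ≤ 4 ^ (2 : ℝ) :=
    Real.rpow_le_rpow_of_exponent_le (by norm_num) (by linarith)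
  have h2 : s ^ (θ - δ) ≤ 1 := Real.rpow_le_one hs.le hs1 (by linarith)
  rw [e]
  have h3 : (4 : ℝ) ^ (2 - θ) * s ^ (θ - δ) ≤ 16 := by
    calc _ ≤ (4 : ℝ) ^ (2 : ℝ) * 1 := by gcongr
      _ = 16 := by norm_num
  calc _ ≤ ENNReal.ofReal 16 := ENNReal.ofReal_le_ofReal h3
    _ = 16 := by norm_num

namespace BackwardFlow

variable {T : ℝ} {S : VPClassicalSolution T} {c : CutoffData} {t : ℝ} (Φ : BackwardFlow T S c t)

/-- A majorant of the velocity integral of the internal field against the density, along the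
backward flow. -/
def majorant (s : ℝ) (x : E3) : ℝ≥0∞ :=
  ∫⁻ v, ((∫⁻ y, (‖Φ.X s x v - y‖ₑ⁻¹) ^ (2 : ℝ) * ENNReal.ofReal (rho S.f (t - s) y))
    + (‖Φ.X s x v - S.ξ (t - s)‖ₑ⁻¹) ^ (2 : ℝ)) * Φ.density s x v

lemma majorant_eq (ht : t ∈ Icc 0 (min 1 T)) {s : ℝ} (hs : s ∈ Icc 0 t) (x : E3) :
    Φ.majorant s x = (∫⁻ v, (∫⁻ y, (‖Φ.X s x v - y‖ₑ⁻¹) ^ (2 : ℝ)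
        * ENNReal.ofReal (rho S.f (t - s) y)) * Φ.density s x v)
      + ∫⁻ v, (‖Φ.X s x v - S.ξ (t - s)‖ₑ⁻¹) ^ (2 : ℝ) * Φ.density s x v := by
  have hX := (Φ.continuous_X ht hs x).measurable
  have h : Measurable fun v => (‖Φ.X s x v - S.ξ (t - s)‖ₑ⁻¹) ^ (2 : ℝ) * Φ.density s x v :=
    ((hX.sub_const _).enorm.inv.pow_const _).mul (Φ.measurable_density_velocity ht hs x)
  rw [majorant, ← lintegral_add_right _ h]
  simp only [add_mul]

end BackwardFlow

/-- The majorant, suitably weighted in time, is bounded in `L^p`. -/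
lemma exists_lintegral_majorant_rpow_le {p γ : ℝ} (hp : 6 ≤ p) (h0 : 0 < γ) (h1 : γ < 1)
    (F M : ℝ) :
    ∃ C : ℝ≥0∞, C ≠ ⊤ ∧ ∀ {T : ℝ} {S : VPClassicalSolution T} {c : CutoffData} {t : ℝ}
      (Φ : BackwardFlow T S c t), supf0 S.f = F → mass S.f 0 = M → t ∈ Icc 0 (min 1 T) →
      ∀ s ∈ Ioc 0 t,
      ∫⁻ x, (ENNReal.ofReal (s ^ (2 - γ / 3)) * Φ.majorant s x) ^ p
        ≤ C * ENNReal.ofReal (Hmom S.f S.ξ S.η (p * (1 + γ) - 3) t) := by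
  obtain ⟨C₁, hC₁, hE⟩ := exists_lintegral_potential_mul_density_le hp (θ := γ / 2) (by positivity)
    (by linarith) F M
  obtain ⟨C₂, hC₂, hF⟩ := exists_lintegral_charge_mul_density_le hp (θ := γ / 3) (by positivity)
    (by linarith) F
  rw [show 1 + 2 * (γ / 2) = 1 + γ by ring] at hE
  rw [show 1 + 3 * (γ / 3) = 1 + γ by ring] at hF
  have hp0 : 0 < p := by linarith
  set k := p * (1 + γ) - 3 with hk
  set j := p * (1 + γ / 2) - 3 with hj
  have hj3 : 3 ≤ j := by nlinarith
  have hjk : j < k := by rw [hj, hk]; nlinarith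
  have hk0 : 0 < k := by linarith
  have hjk1 : 0 ≤ 1 - j / k := sub_nonneg.2 ((div_lt_one hk0).2 hjk).le
  refine ⟨2 ^ (p - 1) * ((16 * C₁) ^ p * (3 ^ 6 * ENNReal.ofReal M ^ (1 - j / k))
    + (16 * C₂) ^ p * 3 ^ 6), ?_, fun {T S c t} Φ hFs hM ht s hs => ?_⟩
  · have : 0 ≤ p - 1 := by linarith
    finiteness
  have hs' : s ∈ Icc 0 t := Ioc_subset_Icc_self hs
  have ht1 : t ≤ 1 := ht.2.trans (min_le_left _ _)
  have htT : t ≤ T := ht.2.trans (min_le_right _ _)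
  have hτ : t - s ∈ Icc 0 t := ⟨by linarith [hs.2], by linarith [hs.1]⟩
  set H := ENNReal.ofReal (Hmom S.f S.ξ S.η k t)
  have hmj := Φ.lintegral_moment_le ht hs' j
  have hmk := Φ.lintegral_moment_le ht hs' k
  have hIj := S.lintegral_weight_rpow_mul_le_interpolate (by linarith : 0 < j) hjk hτ htT
  have hIk := S.lintegral_weight_rpow_mul_le hk0.le hτ htT
  rw [hM] at hIj
  have hpt : ∀ x, (ENNReal.ofReal (s ^ (2 - γ / 3)) * Φ.majorant s x) ^ p
      ≤ 2 ^ (p - 1) * ((16 * C₁) ^ p * H ^ (γ / 2 * p / k) * Φ.moment j s x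
        + (16 * C₂) ^ p * Φ.moment k s x) := by
    intro x
    have h2 := ofReal_rpow_mul_ofReal_div_rpow_le (δ := γ / 3) (θ := γ / 2) hs.1 (hs.2.trans ht1)
      (by linarith) (by positivity)
    have h3 := ofReal_rpow_mul_ofReal_div_rpow_le (δ := γ / 3) (θ := γ / 3) hs.1 (hs.2.trans ht1)
      le_rfl (by positivity)
    have h4 : ENNReal.ofReal (s ^ (2 - γ / 3)) * Φ.majorant s x
        ≤ 16 * C₁ * H ^ (γ / 2 / k) * Φ.moment j s x ^ (1 / p)
          + 16 * C₂ * Φ.moment k s x ^ (1 / p) := by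
      rw [Φ.majorant_eq ht hs', mul_add]
      refine add_le_add ?_ ?_
      · refine (mul_le_mul_right (hE Φ hFs hM ht s hs x) _).trans ?_
        calc _ = (ENNReal.ofReal (s ^ (2 - γ / 3)) * ENNReal.ofReal (4 / s) ^ (2 - γ / 2))
              * C₁ * H ^ (γ / 2 / k) * Φ.moment j s x ^ (1 / p) := by ring
          _ ≤ _ := by gcongr
      · refine (mul_le_mul_right (hF Φ hFs ht s hs x) _).trans ?_
        calc _ = (ENNReal.ofReal (s ^ (2 - γ / 3)) * ENNReal.ofReal (4 / s) ^ (2 - γ / 3))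
              * C₂ * Φ.moment k s x ^ (1 / p) := by ring
          _ ≤ _ := by gcongr
    refine (ENNReal.rpow_le_rpow h4 hp0.le).trans ?_
    refine (ENNReal.rpow_add_le_mul_rpow_add_rpow _ _ (by linarith)).trans (le_of_eq ?_)
    simp only [ENNReal.mul_rpow_of_nonneg _ _ hp0.le, ← ENNReal.rpow_mul,
      one_div_mul_cancel hp0.ne', ENNReal.rpow_one, div_mul_eq_mul_div]
  calc _ ≤ ∫⁻ x, 2 ^ (p - 1) * ((16 * C₁) ^ p * H ^ (γ / 2 * p / k) * Φ.moment j s x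
        + (16 * C₂) ^ p * Φ.moment k s x) := lintegral_mono hpt
    _ = 2 ^ (p - 1) * ((16 * C₁) ^ p * H ^ (γ / 2 * p / k) * (∫⁻ x, Φ.moment j s x)
        + (16 * C₂) ^ p * ∫⁻ x, Φ.moment k s x) := by
      have m1 := Φ.measurable_moment ht hs' j
      have m2 := Φ.measurable_moment ht hs' k
      have : 0 ≤ p - 1 := by linarith
      rw [lintegral_const_mul' _ _ (by finiteness), lintegral_add_left (m1.const_mul _), lintegral_const_mul _ m1, lintegral_const_mul _ m2]
    _ ≤ 2 ^ (p - 1) * ((16 * C₁) ^ p * H ^ (γ / 2 * p / k)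
          * (3 ^ 6 * (ENNReal.ofReal M ^ (1 - j / k) * H ^ (j / k)))
        + (16 * C₂) ^ p * (3 ^ 6 * H)) := by
      gcongr
      · exact hmj.trans (by gcongr)
      · exact hmk.trans (by gcongr)
    _ = _ := by
      have e : H = H ^ (γ / 2 * p / k) * H ^ (j / k) := by
        rw [← ENNReal.rpow_add_of_nonneg _ _ (by positivity) (div_nonneg (by linarith) hk0.le),
          ← add_div, show γ / 2 * p + j = k by rw [hj, hk]; ring, div_self hk0.ne',
          ENNReal.rpow_one]
      rw [show 2 ^ (p - 1) * ((16 * C₁) ^ p * H ^ (γ / 2 * p / k)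
          * (3 ^ 6 * (ENNReal.ofReal M ^ (1 - j / k) * H ^ (j / k)))
        + (16 * C₂) ^ p * (3 ^ 6 * H)) = 2 ^ (p - 1) * ((16 * C₁) ^ p
          * (3 ^ 6 * ENNReal.ofReal M ^ (1 - j / k)) * (H ^ (γ / 2 * p / k) * H ^ (j / k))
        + (16 * C₂) ^ p * 3 ^ 6 * H) by ring, ← e]
      ring

/-- A consequence of Jensen's inequality and Tonelli's theorem: integrating a family of functions
bounded in `L^p` against a measure gives a function in `L^p`. -/
lemma lintegral_lintegral_rpow_le {α β : Type*} [MeasurableSpace α] [MeasurableSpace β]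
    {μ : Measure α} [SFinite μ] {ν : Measure β} [SFinite ν] {p : ℝ} (hp : 1 ≤ p)
    {f : β → α → ℝ≥0∞} (hf : Measurable fun q : β × α => f q.1 q.2) {B : ℝ≥0∞}
    (hB : ∀ᵐ s ∂ν, ∫⁻ x, f s x ^ p ∂μ ≤ B) :
    ∫⁻ x, (∫⁻ s, f s x ∂ν) ^ p ∂μ ≤ ν univ ^ p * B := by
  have hp0 : 0 < p := by linarith
  have hp1 : 0 ≤ p - 1 := by linarith
  have hq : 0 ≤ 1 - 1 / p := sub_nonneg.2 ((div_le_one hp0).2 hp)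
  have hjensen : ∀ x, (∫⁻ s, f s x ∂ν) ^ p ≤ ν univ ^ (p - 1) * ∫⁻ s, f s x ^ p ∂ν := by
    intro x
    have hx : Measurable fun s => f s x := hf.comp measurable_prodMk_right
    have h := ENNReal.lintegral_mul_norm_pow_le (μ := ν) (f := fun _ => 1)
      (g := fun s => f s x ^ p) aemeasurable_const (hx.pow_const p).aemeasurable hq
      (by positivity : 0 ≤ 1 / p) (by ring)
    simp only [ENNReal.one_rpow, one_mul, ← ENNReal.rpow_mul, mul_one_div_cancel hp0.ne',
      ENNReal.rpow_one, lintegral_one] at h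
    refine (ENNReal.rpow_le_rpow h hp0.le).trans (le_of_eq ?_)
    rw [ENNReal.mul_rpow_of_nonneg _ _ hp0.le, ← ENNReal.rpow_mul, ← ENNReal.rpow_mul,
      one_div_mul_cancel hp0.ne', ENNReal.rpow_one, sub_mul, one_mul, one_div_mul_cancel hp0.ne']
  have hm : Measurable fun q : α × β => f q.2 q.1 ^ p := (hf.comp measurable_swap).pow_const p
  calc ∫⁻ x, (∫⁻ s, f s x ∂ν) ^ p ∂μ
      ≤ ∫⁻ x, ν univ ^ (p - 1) * ∫⁻ s, f s x ^ p ∂ν ∂μ := lintegral_mono hjensen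
    _ = ν univ ^ (p - 1) * ∫⁻ s, ∫⁻ x, f s x ^ p ∂μ ∂ν := by
        rw [lintegral_const_mul _ hm.lintegral_prod_right', lintegral_lintegral_swap hm.aemeasurable]
    _ ≤ ν univ ^ (p - 1) * ∫⁻ _, B ∂ν := by
        exact mul_le_mul_right (lintegral_mono_ae hB) _
    _ = ν univ ^ p * B := by
        rw [lintegral_const, mul_comm B, ← mul_assoc]
        congr 1
        nth_rw 2 [← ENNReal.rpow_one (ν univ)]
        rw [← ENNReal.rpow_add_of_nonneg _ _ hp1 zero_le_one, sub_add_cancel]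

lemma setLIntegral_Ioc_ofReal_rpow {t δ : ℝ} (ht : 0 ≤ t) (hδ : 0 < δ) :
    ∫⁻ s in Ioc 0 t, ENNReal.ofReal (s ^ (δ - 1)) = ENNReal.ofReal (t ^ δ / δ) := by
  have hi : IntervalIntegrable (fun s : ℝ => s ^ (δ - 1)) volume 0 t :=
    intervalIntegral.intervalIntegrable_rpow' (by linarith)
  rw [← ofReal_integral_eq_lintegral_ofReal
    ((intervalIntegrable_iff_integrableOn_Ioc_of_le ht).1 hi),
    ← intervalIntegral.integral_of_le ht, integral_rpow (Or.inl (by linarith))]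
  · rw [sub_add_cancel, Real.zero_rpow hδ.ne', sub_zero]
  · filter_upwards [ae_restrict_mem measurableSet_Ioc] with s hs
    exact Real.rpow_nonneg hs.1.le _

/-- Integration in time of a family of functions with a weighted bound in `L^p`. -/
lemma lintegral_setLIntegral_Ioc_mul_rpow_le {α : Type*} [MeasurableSpace α] {μ : Measure α}
    [SFinite μ] {p δ t : ℝ} (hp : 1 ≤ p) (hδ : 0 < δ) (ht : 0 ≤ t) {I : ℝ → α → ℝ≥0∞}
    (hI : Measurable fun q : ℝ × α => I q.1 q.2) {B : ℝ≥0∞}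
    (hB : ∀ s ∈ Ioc 0 t, ∫⁻ x, (ENNReal.ofReal (s ^ (2 - δ)) * I s x) ^ p ∂μ ≤ B) :
    ∫⁻ x, (∫⁻ s in Ioc 0 t, ENNReal.ofReal s * I s x) ^ p ∂μ
      ≤ ENNReal.ofReal (t ^ δ / δ) ^ p * B := by
  set d : ℝ → ℝ≥0∞ := fun s => ENNReal.ofReal (s ^ (δ - 1)) with hd
  have hdm : Measurable d := by fun_prop
  have hm : Measurable fun q : ℝ × α => ENNReal.ofReal (q.1 ^ (2 - δ)) * I q.1 q.2 := by fun_prop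
  set ν := (volume.restrict (Ioc 0 t)).withDensity d with hν
  have hνu : ν univ = ENNReal.ofReal (t ^ δ / δ) := by
    rw [hν, withDensity_apply _ MeasurableSet.univ, Measure.restrict_univ,
      setLIntegral_Ioc_ofReal_rpow ht hδ]
  have e : ∀ x, ∫⁻ s in Ioc 0 t, ENNReal.ofReal s * I s x
      = ∫⁻ s, ENNReal.ofReal (s ^ (2 - δ)) * I s x ∂ν := by
    intro x
    have hx : Measurable fun s => ENNReal.ofReal (s ^ (2 - δ)) * I s x :=
      hm.comp measurable_prodMk_right
    rw [hν, lintegral_withDensity_eq_lintegral_mul _ hdm hx]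
    refine setLIntegral_congr_fun measurableSet_Ioc fun s hs => ?_
    simp only [Pi.mul_apply, hd]
    rw [← mul_assoc, ← ENNReal.ofReal_mul (Real.rpow_nonneg hs.1.le _), ← Real.rpow_add hs.1]
    congr 2
    rw [show δ - 1 + (2 - δ) = 1 by ring, Real.rpow_one]
  simp_rw [e]
  rw [← hνu]
  refine lintegral_lintegral_rpow_le hp hm ?_
  exact (withDensity_absolutelyContinuous _ _).ae_le
    ((ae_restrict_mem measurableSet_Ioc).mono hB)

namespace VPClassicalSolution

variable {T : ℝ} (S : VPClassicalSolution T)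

lemma Hmom_nonneg (k t : ℝ) : 0 ≤ Hmom S.f S.ξ S.η k t := by
  refine Real.sSup_nonneg ?_
  rintro _ ⟨s, -, rfl⟩
  exact integral_nonneg fun q => mul_nonneg
    (Real.rpow_nonneg (by linarith [S.one_le_hEnergy s q.1 q.2]) _) (S.f_nonneg _ _ _)

lemma enorm_Eint_le (c : CutoffData) (t : ℝ) (x : E3) :
    ‖Eint T S.f c t x‖ₑ ≤ ∫⁻ y, (‖x - y‖ₑ⁻¹) ^ (2 : ℝ) * ENNReal.ofReal (rho S.f t y) := by
  refine (enorm_integral_le_lintegral_enorm _).trans (lintegral_mono fun y => ?_)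
  have h1 : chiR T S.f c (x - y) ∈ Icc (0 : ℝ) 1 := c.mem_Icc _
  have h2 := S.rho_nonneg t y
  refine (enorm_coulomb_le (mul_nonneg h1.1 h2) _).trans ?_
  gcongr
  exact mul_le_of_le_one_left h2 h1.2

lemma enorm_Fint_le (c : CutoffData) (t : ℝ) (x : E3) :
    ‖Fint T S.f S.ξ c t x‖ₑ ≤ (‖x - S.ξ t‖ₑ⁻¹) ^ (2 : ℝ) := by
  have h1 : chiR T S.f c (x - S.ξ t) ∈ Icc (0 : ℝ) 1 := c.mem_Icc _
  rw [Fint, Fpt, smul_smul, ← div_eq_mul_inv]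
  refine (enorm_coulomb_le h1.1 _).trans ?_
  calc _ ≤ (‖x - S.ξ t‖ₑ⁻¹) ^ (2 : ℝ) * ENNReal.ofReal 1 := by
        gcongr
        exact h1.2
    _ = _ := by simp

end VPClassicalSolution

namespace BackwardFlow

variable {T : ℝ} {S : VPClassicalSolution T} {c : CutoffData} {t : ℝ} (Φ : BackwardFlow T S c t)

lemma enorm_Dterm_le (ht : 0 ≤ t) (x : E3) :
    ‖Dterm T S c t Φ x‖ₑ ≤ ∫⁻ s in Ioc 0 t, ENNReal.ofReal s * Φ.majorant s x := by
  rw [Dterm, intervalIntegral.integral_of_le ht]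
  refine (enorm_integral_le_lintegral_enorm _).trans
    (setLIntegral_mono_ae' measurableSet_Ioc (Eventually.of_forall fun s hs => ?_))
  rw [enorm_mul, Real.enorm_of_nonneg hs.1.le]
  gcongr
  refine (enorm_integral_le_lintegral_enorm _).trans (lintegral_mono fun v => ?_)
  rw [enorm_mul, enorm_norm, Real.enorm_of_nonneg (S.f_nonneg _ _ _)]
  refine mul_le_mul_left ?_ _
  exact (enorm_add_le _ _).trans (add_le_add (S.enorm_Eint_le c _ _) (S.enorm_Fint_le c _ _))

lemma measurable_majorant_projIcc (ht : t ∈ Icc 0 (min 1 T)) :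
    Measurable fun q : ℝ × E3 => Φ.majorant (projIcc 0 t ht.1 q.1) q.2 := by
  have hs : Continuous fun q : (ℝ × E3) × E3 => t - (projIcc 0 t ht.1 q.1.1 : ℝ) :=
    continuous_const.sub (continuous_subtype_val.comp (continuous_projIcc.comp (by fun_prop)))
  have hmap : Continuous fun q : (ℝ × E3) × E3 =>
      Φ.map (projIcc 0 t ht.1 q.1.1) (q.1.2, q.2) :=
    (Φ.continuous_map_projIcc ht).comp
      (by fun_prop : Continuous fun q : (ℝ × E3) × E3 => (q.1.1, (q.1.2, q.2)))
  have hX := hmap.fst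
  have hd : Measurable fun q : (ℝ × E3) × E3 => Φ.density (projIcc 0 t ht.1 q.1.1) q.1.2 q.2 :=
    (S.continuous_f.comp (hs.prodMk hmap)).measurable.ennreal_ofReal
  have hξ : Measurable fun q : (ℝ × E3) × E3 =>
      (‖Φ.X (projIcc 0 t ht.1 q.1.1) q.1.2 q.2 - S.ξ (t - projIcc 0 t ht.1 q.1.1)‖ₑ⁻¹) ^ (2 : ℝ) :=
    (hX.sub (S.ξ_c2.continuous.comp hs)).measurable.enorm.inv.pow_const _
  have hρ : Measurable fun q : ((ℝ × E3) × E3) × E3 =>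
      ENNReal.ofReal (rho S.f (t - projIcc 0 t ht.1 q.1.1.1) q.2) :=
    (S.measurable_rho.comp ((hs.comp continuous_fst).measurable.prodMk
      measurable_snd)).ennreal_ofReal
  have hk : Measurable fun q : ((ℝ × E3) × E3) × E3 =>
      (‖Φ.X (projIcc 0 t ht.1 q.1.1.1) q.1.1.2 q.1.2 - q.2‖ₑ⁻¹) ^ (2 : ℝ) :=
    ((hX.comp continuous_fst).sub continuous_snd).measurable.enorm.inv.pow_const _
  exact (((hk.mul hρ).lintegral_prod_right'.add hξ).mul hd).lintegral_prod_right'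

end BackwardFlow

lemma exists_eLpNorm_Dterm_le {p γ : ℝ} (hp : 6 ≤ p) (h0 : 0 < γ) (h1 : γ < 1) (F M : ℝ) :
    ∃ C : ℝ, 0 < C ∧ ∀ {T : ℝ} {S : VPClassicalSolution T} {c : CutoffData} {t : ℝ}
      (Φ : BackwardFlow T S c t), supf0 S.f = F → mass S.f 0 = M → t ∈ Icc 0 (min 1 T) →
      eLpNorm (Dterm T S c t Φ) (ENNReal.ofReal p) volume
        ≤ ENNReal.ofReal (C * t ^ (γ / 3) * Hmom S.f S.ξ S.η (p * (1 + γ) - 3) t ^ (1 / p)) := by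
  obtain ⟨C, hC, h⟩ := exists_lintegral_majorant_rpow_le hp h0 h1 F M
  have hp0 : 0 < p := by linarith
  refine ⟨(C ^ (1 / p)).toReal * (3 / γ) + 1, by positivity, fun {T S c t} Φ hF hM ht => ?_⟩
  set H := Hmom S.f S.ξ S.η (p * (1 + γ) - 3) t with hH
  have hH0 : 0 ≤ H := S.Hmom_nonneg _ _
  have hp1 : 1 ≤ p := by linarith
  have hI : ∀ s ∈ Ioc 0 t, ∀ x, Φ.majorant (projIcc 0 t ht.1 s) x = Φ.majorant s x := by
    intro s hs x
    rw [projIcc_of_mem ht.1 (Ioc_subset_Icc_self hs)]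
  have key := lintegral_setLIntegral_Ioc_mul_rpow_le (μ := (volume : Measure E3))
    (I := fun s x => Φ.majorant (projIcc 0 t ht.1 s) x) hp1 (by positivity : 0 < γ / 3) ht.1 (Φ.measurable_majorant_projIcc ht)
    (B := C * ENNReal.ofReal H) (fun s hs => by
      simp only [hI s hs]
      exact h Φ hF hM ht s hs)
  have hle : ∫⁻ x, ‖Dterm T S c t Φ x‖ₑ ^ p
      ≤ ENNReal.ofReal (t ^ (γ / 3) / (γ / 3)) ^ p * (C * ENNReal.ofReal H) := by
    refine le_trans (lintegral_mono fun x => ?_) key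
    refine ENNReal.rpow_le_rpow ((Φ.enorm_Dterm_le ht.1 x).trans (le_of_eq ?_)) hp0.le
    exact setLIntegral_congr_fun measurableSet_Ioc fun s hs => by simp only [hI s hs]
  rw [eLpNorm_eq_lintegral_rpow_enorm_toReal (ENNReal.ofReal_pos.2 hp0).ne' ENNReal.ofReal_ne_top,
    ENNReal.toReal_ofReal hp0.le]
  have hCp : C ^ (1 / p) ≠ ⊤ := by finiteness
  have htγ : 0 ≤ t ^ (γ / 3) := Real.rpow_nonneg ht.1 _
  calc _ ≤ (ENNReal.ofReal (t ^ (γ / 3) / (γ / 3)) ^ p * (C * ENNReal.ofReal H)) ^ (1 / p) := by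
        gcongr
    _ = ENNReal.ofReal (t ^ (γ / 3) / (γ / 3)) * (C ^ (1 / p) * ENNReal.ofReal (H ^ (1 / p))) := by
        rw [ENNReal.mul_rpow_of_nonneg _ _ (by positivity),
          ENNReal.mul_rpow_of_nonneg _ _ (by positivity), ← ENNReal.rpow_mul,
          mul_one_div_cancel hp0.ne', ENNReal.rpow_one,
          ENNReal.ofReal_rpow_of_nonneg hH0 (by positivity)]
    _ = ENNReal.ofReal (t ^ (γ / 3) / (γ / 3) * ((C ^ (1 / p)).toReal * H ^ (1 / p))) := by
        rw [ENNReal.ofReal_mul (by positivity), ENNReal.ofReal_mul ENNReal.toReal_nonneg,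
          ENNReal.ofReal_toReal hCp]
    _ ≤ _ := by
        refine ENNReal.ofReal_le_ofReal ?_
        have : 0 ≤ H ^ (1 / p) := Real.rpow_nonneg hH0 _
        calc _ = (C ^ (1 / p)).toReal * (3 / γ) * t ^ (γ / 3) * H ^ (1 / p) := by
              field_simp
          _ ≤ _ := by
              gcongr
              linarith

/-- Small time estimate for the Duhamel term. -/
theorem statement_15 :
    ∃ C : ℝ → ℝ → ℝ → ℝ → ℝ → ℝ → ℝ,
      (∀ γ m a b c d, 0 < C γ m a b c d) ∧
      ∀ (T : ℝ) (S : VPClassicalSolution T) (c : CutoffData)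
        (t : ℝ), t ∈ Icc (0 : ℝ) (min 1 T) →
      ∀ (Φ : BackwardFlow T S c t) (m γ : ℝ), 3 ≤ m → 0 < γ → γ < 1 →
        eLpNorm (Dterm T S c t Φ) (ENNReal.ofReal (m + 3)) volume
          ≤ ENNReal.ofReal
              (C γ m (energy S.f S.ξ S.η 0) (mass S.f 0) (supf0 S.f) (mass S.f 0)
                * t ^ (γ / (1 + (γ + 1) * (m + 3)))
                * Hmom S.f S.ξ S.η ((m + 3) * (1 + γ) - 3) t ^ (1 / (m + 3))) := by
  have h : ∀ γ m M F : ℝ, ∃ C : ℝ, 0 < C ∧ (3 ≤ m → 0 < γ → γ < 1 →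
      ∀ (T : ℝ) (S : VPClassicalSolution T) (c : CutoffData) (t : ℝ) (Φ : BackwardFlow T S c t),
        supf0 S.f = F → mass S.f 0 = M → t ∈ Icc 0 (min 1 T) →
        eLpNorm (Dterm T S c t Φ) (ENNReal.ofReal (m + 3)) volume
          ≤ ENNReal.ofReal (C * t ^ (γ / 3)
            * Hmom S.f S.ξ S.η ((m + 3) * (1 + γ) - 3) t ^ (1 / (m + 3)))) := by
    intro γ m M F
    by_cases hγ : 3 ≤ m ∧ 0 < γ ∧ γ < 1
    · obtain ⟨C, hC, h⟩ := exists_eLpNorm_Dterm_le (by linarith : 6 ≤ m + 3) hγ.2.1 hγ.2.2 F M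
      exact ⟨C, hC, fun _ _ _ T S c t Φ => h Φ⟩
    · exact ⟨1, one_pos, fun h1 h2 h3 => absurd ⟨h1, h2, h3⟩ hγ⟩
  choose C hC h using h
  refine ⟨fun γ m _ M F _ => C γ m M F, fun γ m _ M F _ => hC γ m M F,
    fun T S c t ht Φ m γ hm h0 h1 => ?_⟩
  refine (h γ m _ _ hm h0 h1 T S c t Φ rfl rfl ht).trans (ENNReal.ofReal_le_ofReal ?_)
  have hH0 : 0 ≤ Hmom S.f S.ξ S.η ((m + 3) * (1 + γ) - 3) t := S.Hmom_nonneg _ _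
  refine mul_le_mul_of_nonneg_right (mul_le_mul_of_nonneg_left ?_ (hC _ _ _ _).le)
    (Real.rpow_nonneg hH0 _)
  refine Real.rpow_le_rpow_of_exponent_ge_of_imp ht.1 (ht.2.trans (min_le_left _ _)) ?_ ?_
  · exact div_le_div_of_nonneg_left h0.le (by norm_num) (by nlinarith)
  · intro _ h
    exact absurd h (by positivity)

end
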